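/- arXiv:1511.03991 — 2 statements merged into one kernel-verified Lean document; each statement's English description precedes it below -/
import Mathlib

section
/- Let M be a finitely generated R-module and let x₁, …, x_d be an M-regular sequence of elements of the maximal ideal of R. Then for every ideal J ⊆ I generated by a Q-regular sequence of length d whose images in V are k-linearly independent: Ext^i_{Q/J}(M,k) ≠ 0 for infinitely many i if and only if Ext^i_{Q/J}(M/(x₁,…,x_d)M, k) ≠ 0 for infinitely many i. (Equivalently, V_R^d(M) = V_R^d(M/(x₁,…,x_d)M).) -/
open CategoryTheory IsLocalRing

/-- A local ring is regular if its maximal ideal can be generated by a regular sequence. -/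
def IsRegularLocal (Q : Type) [CommRing Q] [IsLocalRing Q] : Prop :=
  ∃ rs : List Q, RingTheory.Sequence.IsRegular Q rs ∧
    Ideal.span {x | x ∈ rs} = maximalIdeal Q

theorem Module.IsTorsionBySet.mono' {Q M : Type} [CommRing Q] [AddCommGroup M] [Module Q M]
    {J I : Ideal Q} (h : Module.IsTorsionBySet Q M (I : Set Q)) (hJI : J ≤ I) :
    Module.IsTorsionBySet Q M (J : Set Q) := fun x a => @h x ⟨a.1, hJI a.2⟩

/-- The `Q ⧸ J`-module structure on a module annihilated by `I ⊇ J`. -/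
def modOver {Q : Type} [CommRing Q] {I : Ideal Q} (J : Ideal Q) (hJI : J ≤ I)
    (M : Type) [AddCommGroup M] [Module Q M]
    (hM : Module.IsTorsionBySet Q M (I : Set Q)) : Module (Q ⧸ J) M :=
  (hM.mono' hJI).module

theorem quot_isTorsionBySet (Q : Type) [CommRing Q] (J : Ideal Q) :
    Module.IsTorsionBySet Q (Q ⧸ J) (J : Set Q) := fun x a => by
  induction x using Quotient.inductionOn with
  | h q =>
    show ((a : Q) • Submodule.Quotient.mk q : Q ⧸ J) = 0
    rw [← Submodule.Quotient.mk_smul, Submodule.Quotient.mk_eq_zero, smul_eq_mul]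
    exact Ideal.mul_mem_right q J a.2

/-- The residue field `k = Q/𝔪` as a module over `Q ⧸ J` for any `J ≤ 𝔪`. -/
def kMod {Q : Type} [CommRing Q] [IsLocalRing Q] (J : Ideal Q) (hJm : J ≤ maximalIdeal Q) :
    Module (Q ⧸ J) (Q ⧸ maximalIdeal Q) :=
  modOver J hJm (Q ⧸ maximalIdeal Q) (quot_isTorsionBySet Q (maximalIdeal Q))

/-- `Ext^i_A(M, N)`, as a module over `A`, for explicitly given module structures. -/
noncomputable def extMod (A : Type) [CommRing A] (M N : Type) [AddCommGroup M] [AddCommGroup N]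
    (mM : Module A M) (mN : Module A N) (i : ℕ) : ModuleCat A :=
  ((Ext A (ModuleCat A) i).obj (Opposite.op (@ModuleCat.of A _ M _ mM))).obj
    (@ModuleCat.of A _ N _ mN)

/-- `Ext^i_A(M, N) ≠ 0` for infinitely many `i`. -/
def extInf (A : Type) [CommRing A] (M N : Type) [AddCommGroup M] [AddCommGroup N]
    (mM : Module A M) (mN : Module A N) : Prop :=
  ∀ n : ℕ, ∃ i, n ≤ i ∧ Nontrivial (extMod A M N mM mN i)

/-- `Ext^i_A(M, N) = 0` for all `i ≫ 0`. -/
def extVan (A : Type) [CommRing A] (M N : Type) [AddCommGroup M] [AddCommGroup N]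
    (mM : Module A M) (mN : Module A N) : Prop :=
  ∃ n₀ : ℕ, ∀ i, n₀ ≤ i → Subsingleton (extMod A M N mM mN i)

/-- The images in `V = I/𝔫I` of the elements `g i` of `I` are `k`-linearly independent. -/
def LinIndepInV (Q : Type) [CommRing Q] [IsLocalRing Q] (I : Ideal Q)
    {d : ℕ} (g : Fin d → Q) : Prop :=
  (∀ i, g i ∈ I) ∧
    ∀ a : Fin d → Q, (∑ i, a i * g i) ∈ maximalIdeal Q * I → ∀ i, a i ∈ maximalIdeal Q

/-- The depth of a module over a local ring: the supremum of the lengths of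
regular sequences on the module consisting of elements of the maximal ideal. -/
noncomputable def localDepth (Q : Type) [CommRing Q] [IsLocalRing Q]
    (M : Type) [AddCommGroup M] [Module Q M] : ℕ :=
  sSup {n | ∃ rs : List Q, rs.length = n ∧ (∀ r ∈ rs, r ∈ maximalIdeal Q) ∧
    RingTheory.Sequence.IsRegular M rs}

lemma extCmp (A : Type) [CommRing A] (X Y : ModuleCat.{0} A) (n : ℕ) :
    Subsingleton (((Ext A (ModuleCat.{0} A) (n+1)).obj (Opposite.op X)).obj Y) ↔
    Subsingleton (Abelian.Ext X Y (n+1)) := by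
  let P := projectiveResolution X
  have h1 : Subsingleton (((Ext A (ModuleCat.{0} A) (n+1)).obj (Opposite.op X)).obj Y) ↔
     ∀ f : P.complex.X (n+1) ⟶ Y, P.complex.d (n+2) (n+1) ≫ f = 0 →
      ∃ g : P.complex.X n ⟶ Y, P.complex.d (n+1) n ≫ g = f := by
    rw [← ModuleCat.isZero_iff_subsingleton, (P.isoExt (R := A) (n+1) Y).isZero_iff,
      ← HomologicalComplex.exactAt_iff_isZero_homology,
      HomologicalComplex.exactAt_iff' _ n (n+1) (n+2) (by simp) (by simp),
      ShortComplex.moduleCat_exact_iff]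
    rfl
  rw [h1]
  constructor
  · intro h
    refine subsingleton_of_forall_eq 0 fun α => ?_
    obtain ⟨f, hf, rfl⟩ := P.extMk_surjective α (n+2) rfl
    rw [P.extMk_eq_zero_iff f (n+2) rfl hf n rfl]
    exact h f hf
  · intro h f hf
    exact (P.extMk_eq_zero_iff f (n+2) rfl hf n rfl).1 (Subsingleton.elim _ _)

def VanX {A : Type} [CommRing A] (X Y : ModuleCat.{0} A) : Prop :=
  ∃ n : ℕ, ∀ i, n ≤ i → Subsingleton (Abelian.Ext X Y i)

lemma vanX_iso {A : Type} [CommRing A] {X X' : ModuleCat.{0} A} (Y : ModuleCat.{0} A) (e : X ≅ X')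
    (h : VanX X Y) : VanX X' Y := by
  obtain ⟨n, hn⟩ := h
  refine ⟨n, fun i hi => ?_⟩
  have := hn i hi
  refine subsingleton_of_forall_eq 0 fun α => ?_
  have h1 : (Abelian.Ext.mk₀ e.inv).comp ((Abelian.Ext.mk₀ e.hom).comp α (zero_add i)) (zero_add i) = α := by
    simp
  rw [← h1, Subsingleton.elim ((Abelian.Ext.mk₀ e.hom).comp α (zero_add i)) 0]
  simp

lemma vanX_step {A : Type} [CommRing A] (X Y : ModuleCat.{0} A) (r : A)
    (hr : IsSMulRegular X r) (hY : ∀ y : Y, r • y = 0) :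
    VanX X Y ↔ VanX (ModuleCat.of A (QuotSMulTop r X)) Y := by
  have hS := IsSMulRegular.smulShortComplex_shortExact hr
  have hz : ∀ {i : ℕ} (Z : ModuleCat.{0} A) (α : Abelian.Ext Z Y i), r • α = 0 := by
    intro i Z α
    rw [Abelian.Ext.smul_eq_comp_mk₀]
    have : r • 𝟙 Y = 0 := by ext y; exact hY y
    rw [this]; simp
  have hf : ∀ {i : ℕ} (α : Abelian.Ext X Y i),
      (Abelian.Ext.mk₀ (X.smulShortComplex r).f).comp α (zero_add i) = 0 := by
    intro i α
    change (Abelian.Ext.mk₀ (r • 𝟙 X)).comp α (zero_add i) = 0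
    rw [Abelian.Ext.mk₀_smul, Abelian.Ext.smul_comp, hz X]
  constructor
  · rintro ⟨n, hn⟩
    refine ⟨n+1, fun i hi => subsingleton_of_forall_eq 0 fun α => ?_⟩
    obtain ⟨j, rfl⟩ := Nat.exists_eq_add_of_le' (show 1 ≤ i by omega)
    obtain ⟨β, hβ⟩ := Abelian.Ext.contravariant_sequence_exact₃ hS Y α
      (@Subsingleton.elim _ (hn (j+1) (by omega)) _ _) (n₀ := j) (by omega)
    have h0 : β = 0 := @Subsingleton.elim _ (hn j (by omega)) β 0
    rw [← hβ, h0]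
    exact Abelian.Ext.comp_zero ..
  · rintro ⟨n, hn⟩
    refine ⟨n, fun i hi => subsingleton_of_forall_eq 0 fun α => ?_⟩
    obtain ⟨β, hβ⟩ := Abelian.Ext.contravariant_sequence_exact₁ hS Y α (n₁ := i+1) (by omega)
      (@Subsingleton.elim _ (hn (i+1) (by omega)) _ _)
    rw [← hβ]
    exact hf β

lemma vanX_list {A : Type} [CommRing A] (Y : ModuleCat.{0} A) (rs : List A) :
    ∀ (X : ModuleCat.{0} A) (N : ModuleCat.{0} A)
    (_ : N ≃ₗ[A] (X ⧸ (Ideal.ofList rs • ⊤ : Submodule A X)))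
    (_ : RingTheory.Sequence.IsWeaklyRegular X rs) (_ : ∀ r ∈ rs, ∀ y : Y, r • y = 0),
    VanX X Y ↔ VanX N Y := by
  induction rs with
  | nil =>
    intro X N e _ _
    have h : (Ideal.ofList ([] : List A) • ⊤ : Submodule A X) = ⊥ := by simp
    let e' : N ≃ₗ[A] X := e ≪≫ₗ Submodule.quotEquivOfEqBot _ h
    exact ⟨vanX_iso Y e'.toModuleIso.symm, vanX_iso Y e'.toModuleIso⟩
  | cons r rs ih =>
    intro X N e hreg hY
    rw [RingTheory.Sequence.isWeaklyRegular_cons_iff] at hreg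
    rw [vanX_step X Y r hreg.1 (hY r (by simp))]
    exact ih (ModuleCat.of A (QuotSMulTop r X)) N
      (e ≪≫ₗ Submodule.quotOfListConsSMulTopEquivQuotSMulTopInner X r rs) hreg.2
      (fun s hs => hY s (by simp [hs]))


lemma extInf_iff (A : Type) [CommRing A] (M N : Type) [AddCommGroup M] [AddCommGroup N]
    (mM : Module A M) (mN : Module A N) :
    extInf A M N mM mN ↔ ¬ VanX (ModuleCat.of A M) (ModuleCat.of A N) := by
  have key : ∀ n, Subsingleton (extMod A M N mM mN (n+1)) ↔
      Subsingleton (Abelian.Ext (ModuleCat.of A M) (ModuleCat.of A N) (n+1)) :=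
    fun n => extCmp A _ _ n
  constructor
  · rintro h ⟨n, hn⟩
    obtain ⟨i, hi, hnt⟩ := h (n+1)
    obtain ⟨j, rfl⟩ := Nat.exists_eq_add_of_le' (show 1 ≤ i by omega)
    exact not_subsingleton_iff_nontrivial.2 hnt ((key j).2 (hn _ (by omega)))
  · intro h n
    by_contra hc
    push Not at hc
    refine h ⟨n+1, fun i hi => ?_⟩
    obtain ⟨j, rfl⟩ := Nat.exists_eq_add_of_le' (show 1 ≤ i by omega)
    exact (key j).1 (hc (j+1) (by omega))

lemma main_aux {Q A : Type} [CommRing Q] [CommRing A] [Algebra Q A]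
    (hs : Function.Surjective (algebraMap Q A))
    (M M' Y : Type) [AddCommGroup M] [AddCommGroup M'] [AddCommGroup Y]
    [Module Q M] [Module Q M'] [Module Q Y] [Module A M] [Module A M'] [Module A Y]
    [IsScalarTower Q A M] [IsScalarTower Q A M'] [IsScalarTower Q A Y]
    (rs : List Q) (e : M' ≃ₗ[Q] (M ⧸ (Ideal.ofList rs • ⊤ : Submodule Q M)))
    (hreg : RingTheory.Sequence.IsWeaklyRegular M rs) (hY : ∀ r ∈ rs, ∀ y : Y, r • y = 0) :
    VanX (ModuleCat.of A M) (ModuleCat.of A Y) ↔ VanX (ModuleCat.of A M') (ModuleCat.of A Y) := by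
  have hreg' := (RingTheory.Sequence.isWeaklyRegular_map_algebraMap_iff (S := A) M rs).2 hreg
  let g : M →ₗ[Q] M' := e.symm.toLinearMap ∘ₗ Submodule.mkQ _
  have hg : Function.Surjective g := e.symm.surjective.comp (Submodule.mkQ_surjective _)
  have hker : LinearMap.ker g = (Ideal.ofList rs • ⊤ : Submodule Q M) := by
    simp [g, LinearMap.ker_comp]
  let gA : M →ₗ[A] M' :=
    { toFun := g
      map_add' := g.map_add
      map_smul' := fun a m => by
        obtain ⟨q, rfl⟩ := hs a
        simp [algebraMap_smul] }
  have hkA : LinearMap.ker gA = (Ideal.ofList (rs.map (algebraMap Q A)) • ⊤ : Submodule A M) := by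
    apply Submodule.restrictScalars_injective Q
    rw [← Ideal.map_ofList, Ideal.smul_restrictScalars]
    refine Eq.trans ?_ hker
    ext; rfl
  let eA : M' ≃ₗ[A] (M ⧸ (Ideal.ofList (rs.map (algebraMap Q A)) • ⊤ : Submodule A M)) :=
    (gA.quotKerEquivOfSurjective hg).symm ≪≫ₗ Submodule.quotEquivOfEq _ _ hkA
  refine vanX_list (ModuleCat.of A Y) (rs.map (algebraMap Q A)) (ModuleCat.of A M) (ModuleCat.of A M')
    eA hreg' ?_
  intro r hr y
  obtain ⟨q, hq, rfl⟩ := List.mem_map.1 hr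
  change algebraMap Q A q • (show Y from y) = 0
  rw [algebraMap_smul]
  exact hY q hq y

/-- If `x₁, …, x_d` is an `M`-regular sequence, then
`V_R^d(M) = V_R^d(M/(x₁,…,x_d)M)`, pointwise. -/
theorem statement11
    (Q : Type) [CommRing Q] [IsLocalRing Q] [IsNoetherianRing Q]
    (hQreg : IsRegularLocal Q)
    (c : ℕ) (hc : 1 ≤ c) (f : Fin c → Q)
    (hfreg : RingTheory.Sequence.IsRegular Q (List.ofFn f))
    (I : Ideal Q) (hIf : I = Ideal.span (Set.range f))
    (hIsq : I ≤ maximalIdeal Q ^ 2)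
    (M : Type) [AddCommGroup M] [Module Q M] [Module.Finite Q M]
    (hM : Module.IsTorsionBySet Q M (I : Set Q))
    (d : ℕ) (x : Fin d → Q) (hx𝔪 : ∀ i, x i ∈ maximalIdeal Q)
    (hxreg : RingTheory.Sequence.IsRegular M (List.ofFn x))
    (g : Fin d → Q)
    (hgreg : RingTheory.Sequence.IsRegular Q (List.ofFn g))
    (hglin : LinIndepInV Q I g)
    (J : Ideal Q) (hJg : J = Ideal.span (Set.range g)) (hJI : J ≤ I) :
    extInf (Q ⧸ J) M (Q ⧸ maximalIdeal Q) (modOver J hJI M hM) (kMod J (hJI.trans (hIsq.trans (Ideal.pow_le_self two_ne_zero)))) ↔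
      extInf (Q ⧸ J) (M ⧸ (Ideal.span (Set.range x) • (⊤ : Submodule Q M)))
        (Q ⧸ maximalIdeal Q)
        (modOver J hJI (M ⧸ (Ideal.span (Set.range x) • (⊤ : Submodule Q M)))
          (Module.IsTorsionBySet.quotient _ hM))
        (kMod J (hJI.trans (hIsq.trans (Ideal.pow_le_self two_ne_zero)))) := by
  
  rw [extInf_iff, extInf_iff, not_iff_not]
  have hJm : J ≤ maximalIdeal Q := hJI.trans (hIsq.trans (Ideal.pow_le_self two_ne_zero))
  have hs : Ideal.ofList (List.ofFn x) = Ideal.span (Set.range x) := by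
    simp [Ideal.ofList, List.mem_ofFn, Set.range]
  letI m1 : Module (Q ⧸ J) M := modOver J hJI M hM
  letI m2 : Module (Q ⧸ J) (M ⧸ (Ideal.span (Set.range x) • (⊤ : Submodule Q M))) :=
    modOver J hJI (M ⧸ (Ideal.span (Set.range x) • (⊤ : Submodule Q M)))
          (Module.IsTorsionBySet.quotient _ hM)
  letI m3 : Module (Q ⧸ J) (Q ⧸ maximalIdeal Q) := kMod J hJm
  have t1 : IsScalarTower Q (Q ⧸ J) M := (hM.mono' hJI).isScalarTower
  have t2 : IsScalarTower Q (Q ⧸ J) (M ⧸ (Ideal.span (Set.range x) • (⊤ : Submodule Q M))) :=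
    ((Module.IsTorsionBySet.quotient _ hM).mono' hJI).isScalarTower
  have t3 : IsScalarTower Q (Q ⧸ J) (Q ⧸ maximalIdeal Q) :=
    ((quot_isTorsionBySet Q (maximalIdeal Q)).mono' hJm).isScalarTower
  refine main_aux (Q := Q) (A := Q ⧸ J) Ideal.Quotient.mk_surjective M _ (Q ⧸ maximalIdeal Q)
    (List.ofFn x) (Submodule.quotEquivOfEq _ _ (by rw [hs])) hxreg.toIsWeaklyRegular ?_
  intro r hr y
  obtain ⟨i, rfl⟩ := List.mem_ofFn.1 hr
  exact quot_isTorsionBySet Q (maximalIdeal Q) (x := y) (a := ⟨x i, hx𝔪 i⟩)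
end

section
/- Assume k is algebraically closed and fix the basis f̄₁, …, f̄_c of V. For every homogeneous ideal 𝔞 of the polynomial ring k[y₁, …, y_c] there exists a finitely generated R-module M such that for every f ∈ I with f̄ ≠ 0 in V, writing f̄ = a₁f̄₁ + ⋯ + a_cf̄_c with a₁, …, a_c ∈ k, one has: Ext^i_{Q/(f)}(M,k) ≠ 0 for infinitely many i if and only if every polynomial in 𝔞 vanishes at (a₁, …, a_c). (Equivalently, every closed subset of G₁(V) is realized as V_R^1(M,k) for some finitely generated R-module M.) -/
open CategoryTheory IsLocalRing

theorem bridge {A : Type} [CommRing A] (X Y : ModuleCat.{0} A) (p : ℕ) :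
    Subsingleton (((Ext A (ModuleCat A) (p+1)).obj (Opposite.op X)).obj Y : ModuleCat A) ↔
      Subsingleton (Abelian.Ext X Y (p+1)) := by
  let P := ProjectiveResolution.of X
  have e := P.isoExt (R := A) (p+1) Y
  rw [← ModuleCat.isZero_iff_subsingleton, Iso.isZero_iff e,
    ← HomologicalComplex.exactAt_iff_isZero_homology,
    HomologicalComplex.exactAt_iff' _ p (p+1) (p+2) (by simp) (by simp),
    ShortComplex.moduleCat_exact_iff]
  constructor
  · intro h
    refine subsingleton_of_forall_eq 0 fun α => ?_
    obtain ⟨f, hf, rfl⟩ := P.extMk_surjective α (p+2) rfl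
    rw [P.extMk_eq_zero_iff _ _ _ _ p rfl]
    obtain ⟨g, hg⟩ := h f hf
    exact ⟨g, hg⟩
  · intro h f hf
    obtain ⟨g, hg⟩ := (P.extMk_eq_zero_iff f (p+2) rfl hf p rfl).1 (Subsingleton.elim _ _)
    exact ⟨g, hg⟩

section
variable {Q : Type} [CommRing Q] (f₀ : Q)

theorem tors {X : Type} [AddCommGroup X] [Module Q X] (hX : ∀ x : X, f₀ • x = 0) :
    Module.IsTorsionBySet Q X (Ideal.span {f₀} : Ideal Q) :=
  (Module.isTorsionBySet_span_singleton_iff f₀).2 (fun x => hX x)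

abbrev AObj (X : Type) [AddCommGroup X] [Module Q X] (hX : ∀ x : X, f₀ • x = 0) :
    ModuleCat.{0} (Q ⧸ Ideal.span {f₀}) :=
  @ModuleCat.of _ _ X _ (tors f₀ hX).module

def AHom {X Y : Type} [AddCommGroup X] [Module Q X] [AddCommGroup Y] [Module Q Y]
    {hX : ∀ x : X, f₀ • x = 0} {hY : ∀ x : Y, f₀ • x = 0} (g : X →ₗ[Q] Y) :
    AObj f₀ X hX ⟶ AObj f₀ Y hY :=
  letI := (tors f₀ hX).module
  letI := (tors f₀ hY).module
  ModuleCat.ofHom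
    { toFun := g
      map_add' := g.map_add
      map_smul' := by
        intro r x
        obtain ⟨r, rfl⟩ := Ideal.Quotient.mk_surjective r
        exact g.map_smul r x }

variable {f₀}
variable {X Y Z : Type} [AddCommGroup X] [Module Q X] [AddCommGroup Y] [Module Q Y]
  [AddCommGroup Z] [Module Q Z]
    {hX : ∀ x : X, f₀ • x = 0} {hY : ∀ x : Y, f₀ • x = 0} {hZ : ∀ x : Z, f₀ • x = 0}

theorem AHom_apply (g : X →ₗ[Q] Y) (x : X) :
    (AHom f₀ (hX := hX) (hY := hY) g).hom x = g x := rfl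

theorem AHom_id : AHom f₀ (hX := hX) (hY := hX) (LinearMap.id) = 𝟙 _ := rfl
theorem AHom_comp (g : X →ₗ[Q] Y) (h : Y →ₗ[Q] Z) :
   AHom f₀ (hX := hX) (hY := hZ) (h ∘ₗ g) = AHom f₀ (hX := hX) (hY := hY) g ≫ AHom f₀ h := rfl
theorem AHom_add (g h : X →ₗ[Q] Y)  :
   AHom f₀ (hX := hX) (hY := hY) (g + h) = AHom f₀ g + AHom f₀ h := rfl
theorem AHom_smul (r : Q) (h : X →ₗ[Q] Y)  :
   AHom f₀ (hX := hX) (hY := hY) (r • h) = (Ideal.Quotient.mk (Ideal.span {f₀}) r) • AHom f₀ h := rfl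

theorem ses (g : X →ₗ[Q] Y) (h : Y →ₗ[Q] Z) (hg : Function.Injective g)
    (hh : Function.Surjective h) (he : Function.Exact g h) :
    (ShortComplex.mk (AHom f₀ (hX := hX) (hY := hY) g) (AHom f₀ (hY := hZ) h)
      (by rw [← AHom_comp, he.linearMap_comp_eq_zero]; rfl)).ShortExact where
  exact := by
    rw [ShortComplex.moduleCat_exact_iff]
    intro x hx
    exact (he x).1 hx
  mono_f := by rw [ModuleCat.mono_iff_injective]; exact hg
  epi_g := by rw [ModuleCat.epi_iff_surjective]; exact hh



variable (hX hY hZ)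
variable (K : Type) [AddCommGroup K] [Module Q K] (hK : ∀ x : K, f₀ • x = 0)

abbrev EX (i : ℕ) : Type := Abelian.Ext (AObj f₀ X hX) (AObj f₀ K hK) i

noncomputable def pre (g : X →ₗ[Q] Y) (i : ℕ) : EX hY K hK i →+ EX hX K hK i :=
  (Abelian.Ext.mk₀ (AHom f₀ (hX := hX) (hY := hY) g)).precomp _ (zero_add i)

theorem pre_apply (g : X →ₗ[Q] Y) (i : ℕ) (x : EX hY K hK i) :
    pre hX hY K hK g i x = (Abelian.Ext.mk₀ (AHom f₀ (hX := hX) (hY := hY) g)).comp x (zero_add i) :=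
  rfl

theorem pre_id (i : ℕ) (x : EX hX K hK i) : pre hX hX K hK LinearMap.id i x = x := by
  rw [pre_apply, AHom_id]; simp

theorem pre_comp (g : X →ₗ[Q] Y) (h : Y →ₗ[Q] Z) (i : ℕ) (x : EX hZ K hK i) :
    pre hX hZ K hK (h ∘ₗ g) i x = pre hX hY K hK g i (pre hY hZ K hK h i x) := by
  simp only [pre_apply]
  rw [AHom_comp (hX := hX) (hY := hY) (hZ := hZ), ← Abelian.Ext.mk₀_comp_mk₀,
    Abelian.Ext.comp_assoc]
  omega

theorem pre_add (g h : X →ₗ[Q] Y) (i : ℕ) (x : EX hY K hK i) :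
    pre hX hY K hK (g + h) i x = pre hX hY K hK g i x + pre hX hY K hK h i x := by
  simp only [pre_apply]
  rw [AHom_add, Abelian.Ext.mk₀_add, Abelian.Ext.add_comp]

theorem pre_smul (r : Q) (g : X →ₗ[Q] Y) (i : ℕ) (x : EX hY K hK i) :
    pre hX hY K hK (r • g) i x =
      (Ideal.Quotient.mk (Ideal.span {f₀}) r) • pre hX hY K hK g i x := by
  simp only [pre_apply]
  rw [AHom_smul, Abelian.Ext.mk₀_smul, Abelian.Ext.smul_comp]

theorem EX_smul_zero (r : Q) (hr : ∀ x : K, r • x = 0) (i : ℕ) (x : EX hX K hK i) :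
    (Ideal.Quotient.mk (Ideal.span {f₀}) r) • x = 0 := by
  rw [Abelian.Ext.smul_eq_comp_mk₀]
  have : (Ideal.Quotient.mk (Ideal.span {f₀}) r) • 𝟙 (AObj f₀ K hK) = 0 := by
    change AHom f₀ (r • (LinearMap.id : K →ₗ[Q] K)) = 0
    rw [show r • (LinearMap.id : K →ₗ[Q] K) = 0 from LinearMap.ext hr]
    rfl
  rw [this]; simp

def Van : Prop := ∃ n, ∀ i ≥ n, Subsingleton (EX hX K hK i)

def EvBij (g : X →ₗ[Q] Y) : Prop := ∃ n, ∀ i ≥ n, Function.Bijective (pre hX hY K hK g i)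

variable {hX hY hZ K hK}

theorem pre_surj (g : X →ₗ[Q] Y) (h : Y →ₗ[Q] Z) (hg : Function.Injective g)
    (hh : Function.Surjective h) (he : Function.Exact g h) (i : ℕ)
    (h1 : Subsingleton (EX hZ K hK (i+1))) : Function.Surjective (pre hX hY K hK g i) := by
  intro x
  exact Abelian.Ext.contravariant_sequence_exact₁ (ses (hX := hX) (hY := hY) (hZ := hZ) g h hg hh he)
    (AObj f₀ K hK) x (add_comm 1 i) (h1.elim _ _)

theorem pre_inj (g : X →ₗ[Q] Y) (h : Y →ₗ[Q] Z) (hg : Function.Injective g)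
    (hh : Function.Surjective h) (he : Function.Exact g h) (i : ℕ)
    (h1 : Subsingleton (EX hZ K hK i)) : Function.Injective (pre hX hY K hK g i) := by
  rw [injective_iff_map_eq_zero]
  intro x hx
  obtain ⟨y, rfl⟩ := Abelian.Ext.contravariant_sequence_exact₂
    (ses (hX := hX) (hY := hY) (hZ := hZ) g h hg hh he)
    (AObj f₀ K hK) x hx
  rw [h1.elim y 0]; simp

theorem EX_sub (g : X →ₗ[Q] Y) (h : Y →ₗ[Q] Z) (hg : Function.Injective g)
    (hh : Function.Surjective h) (he : Function.Exact g h) (i : ℕ)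
    (h1 : Function.Surjective (pre hX hY K hK g i))
    (h2 : Function.Injective (pre hX hY K hK g (i+1))) : Subsingleton (EX hZ K hK (i+1)) := by
  have S := (ses (hX := hX) (hY := hY) (hZ := hZ) g h hg hh he)
  refine subsingleton_of_forall_eq 0 fun x => ?_
  have h3 : pre hY hZ K hK h (i+1) x = 0 := by
    apply h2
    rw [← pre_comp, he.linearMap_comp_eq_zero, map_zero]
    have := pre_smul hX hZ K hK 0 (0 : X →ₗ[Q] Z) (i+1) x
    simpa using this
  obtain ⟨y, rfl⟩ := Abelian.Ext.contravariant_sequence_exact₃ S (AObj f₀ K hK) x h3 (add_comm 1 i)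
  obtain ⟨z, rfl⟩ := h1 y
  rw [pre_apply]
  exact Abelian.Ext.comp_assoc_of_second_deg_zero .. |>.symm.trans (by
    have := S.extClass_comp
    erw [this]
    simp)

theorem van_iff_evBij (g : X →ₗ[Q] Y) (h : Y →ₗ[Q] Z) (hg : Function.Injective g)
    (hh : Function.Surjective h) (he : Function.Exact g h) :
    Van hZ K hK ↔ EvBij hX hY K hK g := by
  constructor
  · rintro ⟨n, hn⟩
    exact ⟨n, fun i hi => ⟨pre_inj g h hg hh he i (hn i hi),
      pre_surj g h hg hh he i (hn _ (by omega))⟩⟩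
  · rintro ⟨n, hn⟩
    refine ⟨n+1, fun i hi => ?_⟩
    obtain ⟨j, rfl⟩ : ∃ j, i = j + 1 := ⟨i-1, by omega⟩
    exact EX_sub g h hg hh he j (hn j (by omega)).2 (hn _ (by omega)).1

theorem EvBij.van_iff {g : X →ₗ[Q] Y} (hg : EvBij hX hY K hK g) : Van hX K hK ↔ Van hY K hK := by
  obtain ⟨n, hn⟩ := hg
  constructor
  · rintro ⟨m, hm⟩
    refine ⟨max n m, fun i hi => ?_⟩
    have := hm i (by omega)
    exact (hn i (by omega)).1.subsingleton
  · rintro ⟨m, hm⟩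
    refine ⟨max n m, fun i hi => ?_⟩
    have := hm i (by omega)
    exact (hn i (by omega)).2.subsingleton

theorem evBij_of_van (g : X →ₗ[Q] Y) (h1 : Van hX K hK) (h2 : Van hY K hK) :
    EvBij hX hY K hK g := by
  obtain ⟨n, hn⟩ := h1
  obtain ⟨m, hm⟩ := h2
  refine ⟨max n m, fun i hi => ?_⟩
  have := hn i (by omega)
  have := hm i (by omega)
  exact ⟨Function.injective_of_subsingleton _, fun y => ⟨0, Subsingleton.elim _ _⟩⟩

theorem van3 (g : X →ₗ[Q] Y) (h : Y →ₗ[Q] Z) (hg : Function.Injective g)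
    (hh : Function.Surjective h) (he : Function.Exact g h) (h1 : Van hX K hK) (h2 : Van hY K hK) :
    Van hZ K hK := (van_iff_evBij g h hg hh he).2 (evBij_of_van g h1 h2)
theorem van2 (g : X →ₗ[Q] Y) (h : Y →ₗ[Q] Z) (hg : Function.Injective g)
    (hh : Function.Surjective h) (he : Function.Exact g h) (h1 : Van hX K hK) (h2 : Van hZ K hK) :
    Van hY K hK := ((van_iff_evBij g h hg hh he).1 h2).van_iff.1 h1
theorem van1 (g : X →ₗ[Q] Y) (h : Y →ₗ[Q] Z) (hg : Function.Injective g)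
    (hh : Function.Surjective h) (he : Function.Exact g h) (h1 : Van hY K hK) (h2 : Van hZ K hK) :
    Van hX K hK := ((van_iff_evBij g h hg hh he).1 h2).van_iff.2 h1

theorem EvBij.comp_iff_left {g : X →ₗ[Q] Y} (hg : EvBij hX hY K hK g) (h : Y →ₗ[Q] Z) :
    EvBij hX hZ K hK (h ∘ₗ g) ↔ EvBij hY hZ K hK h := by
  obtain ⟨n, hn⟩ := hg
  have key : ∀ i ≥ n, (Function.Bijective (pre hX hZ K hK (h ∘ₗ g) i) ↔
      Function.Bijective (pre hY hZ K hK h i)) := fun i hi => by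
    have : (pre hX hZ K hK (h ∘ₗ g) i : _ → _) = pre hX hY K hK g i ∘ pre hY hZ K hK h i := by
      ext x; exact pre_comp ..
    rw [this, Function.Bijective.of_comp_iff' (hn i hi)]
  constructor
  · rintro ⟨m, hm⟩
    exact ⟨max n m, fun i hi => (key i (by omega)).1 (hm i (by omega))⟩
  · rintro ⟨m, hm⟩
    exact ⟨max n m, fun i hi => (key i (by omega)).2 (hm i (by omega))⟩

theorem EvBij.comp_iff_right {h : Y →ₗ[Q] Z} (hh : EvBij hY hZ K hK h) (g : X →ₗ[Q] Y) :
    EvBij hX hZ K hK (h ∘ₗ g) ↔ EvBij hX hY K hK g := by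
  obtain ⟨n, hn⟩ := hh
  have key : ∀ i ≥ n, (Function.Bijective (pre hX hZ K hK (h ∘ₗ g) i) ↔
      Function.Bijective (pre hX hY K hK g i)) := fun i hi => by
    have : (pre hX hZ K hK (h ∘ₗ g) i : _ → _) = pre hX hY K hK g i ∘ pre hY hZ K hK h i := by
      ext x; exact pre_comp ..
    rw [this, Function.Bijective.of_comp_iff _ (hn i hi)]
  constructor
  · rintro ⟨m, hm⟩
    exact ⟨max n m, fun i hi => (key i (by omega)).1 (hm i (by omega))⟩
  · rintro ⟨m, hm⟩
    exact ⟨max n m, fun i hi => (key i (by omega)).2 (hm i (by omega))⟩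

theorem evBij_id : EvBij hX hX K hK LinearMap.id := by
  refine ⟨0, fun i _ => ?_⟩
  have : (pre hX hX K hK LinearMap.id i : _ → _) = id := by ext x; exact pre_id ..
  rw [this]; exact Function.bijective_id

theorem evBij_equiv (e : X ≃ₗ[Q] Y) : EvBij hX hY K hK e.toLinearMap := by
  refine ⟨0, fun i _ => ?_⟩
  rw [Function.bijective_iff_has_inverse]
  refine ⟨pre hY hX K hK e.symm.toLinearMap i, fun x => ?_, fun x => ?_⟩
  · rw [← pre_comp]
    convert pre_id hY K hK i x
    ext; simp
  · rw [← pre_comp]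
    convert pre_id hX K hK i x
    ext; simp

theorem van_equiv (e : X ≃ₗ[Q] Y) : Van hX K hK ↔ Van hY K hK := (evBij_equiv e).van_iff

theorem van_of_subsingleton [Subsingleton X] : Van hX K hK := by
  refine ⟨0, fun i _ => subsingleton_of_forall_eq 0 fun x => ?_⟩
  rw [← pre_id hX K hK i x]
  have h := pre_smul hX hX K hK 0 LinearMap.id i x
  rw [map_zero, zero_smul Q] at h
  have e : (LinearMap.id : X →ₗ[Q] X) = (0 : Q) • LinearMap.id := Subsingleton.elim _ _
  rw [e, zero_smul Q, h]
  exact zero_smul _ _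

theorem van_prod (h1 : Van hX K hK) (h2 : Van hY K hK)
    (h : ∀ x : X × Y, f₀ • x = 0) : Van h K hK :=
  van2 (LinearMap.inl Q X Y) (LinearMap.snd Q X Y) LinearMap.inl_injective LinearMap.snd_surjective
    (Function.Exact.inl_snd) h1 h2

theorem van_pi (h1 : Van hX K hK) (m : ℕ) (h : ∀ x : Fin m → X, f₀ • x = 0) : Van h K hK := by
  induction m with
  | zero => exact van_of_subsingleton
  | succ m ih =>
    have h' : ∀ x : Fin m → X, f₀ • x = 0 := fun x => by ext i; exact hX _
    have hXm : ∀ x : X × (Fin m → X), f₀ • x = 0 := fun x => Prod.ext (hX _) (h' _)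
    exact (van_equiv (Fin.consLinearEquiv Q (fun _ => X))).1
      (van_prod (hX := hX) (hY := h') h1 (ih h') hXm)

theorem evBij_fst (h2 : Van hY K hK) (h : ∀ x : X × Y, f₀ • x = 0) :
    EvBij h hX K hK (LinearMap.fst Q X Y) := by
  have h1 : EvBij hX h K hK (LinearMap.inl Q X Y) :=
    (van_iff_evBij (LinearMap.inl Q X Y) (LinearMap.snd Q X Y) LinearMap.inl_injective
      LinearMap.snd_surjective (Function.Exact.inl_snd)).1 h2
  rw [← h1.comp_iff_left, LinearMap.fst_comp_inl]
  exact evBij_id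

/-- free modules over the quotient have vanishing positive Ext. -/
theorem EX_quot (r i : ℕ) (h : ∀ x : Fin r → (Q ⧸ Ideal.span {f₀}), f₀ • x = 0) :
    Subsingleton (EX h K hK (i+1)) := by
  have : Projective (AObj f₀ (Fin r → (Q ⧸ Ideal.span {f₀})) h) := by
    have e : (tors f₀ h).module = Pi.Function.module (Fin r) (Q ⧸ Ideal.span {f₀})
        (Q ⧸ Ideal.span {f₀}) := by
      refine Module.ext' _ _ fun r x => ?_
      obtain ⟨r, rfl⟩ := Ideal.Quotient.mk_surjective r
      rfl
    change Projective (@ModuleCat.of _ _ _ _ (tors f₀ h).module)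
    rw [e]
    infer_instance
  exact Abelian.Ext.subsingleton_of_projective ..

theorem van_quot (r : ℕ) (h : ∀ x : Fin r → (Q ⧸ Ideal.span {f₀}), f₀ • x = 0) :
    Van h K hK := by
  refine ⟨1, fun i hi => ?_⟩
  obtain ⟨j, rfl⟩ : ∃ j, i = j + 1 := ⟨i-1, by omega⟩
  exact EX_quot r j h

theorem hquot (x : Q ⧸ Ideal.span {f₀}) : f₀ • x = 0 := by
  obtain ⟨x, rfl⟩ := Ideal.Quotient.mk_surjective x
  exact Ideal.Quotient.eq_zero_iff_mem.2 (Ideal.mul_mem_right _ _ (Ideal.mem_span_singleton_self _))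

theorem van_quot1 : Van (hquot (f₀ := f₀)) K hK := by
  have h : ∀ x : Fin 1 → (Q ⧸ Ideal.span {f₀}), f₀ • x = 0 := fun x => by ext i; exact hquot _
  exact (van_equiv (LinearEquiv.funUnique (Fin 1) Q (Q ⧸ Ideal.span {f₀}))).1 (van_quot 1 h)

theorem hqst (L : Type) [AddCommGroup L] [Module Q L] (x : QuotSMulTop f₀ L) : f₀ • x = 0 := by
  obtain ⟨x, rfl⟩ := Submodule.Quotient.mk_surjective _ x
  rw [← Submodule.Quotient.mk_smul, Submodule.Quotient.mk_eq_zero]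
  exact Submodule.smul_mem_pointwise_smul _ _ _ trivial

open Pointwise in
/-- a free module mod `f₀`. -/
theorem van_free (L : Type) [AddCommGroup L] [Module Q L] [Module.Finite Q L] [Module.Free Q L] :
    Van (hqst (f₀ := f₀) L) K hK := by
  rcases subsingleton_or_nontrivial Q with hQ | hQ
  · have : Subsingleton L := Module.subsingleton Q L
    have : Subsingleton (QuotSMulTop f₀ L) := inferInstanceAs (Subsingleton (L ⧸ _))
    exact van_of_subsingleton
  let b := Module.finBasis Q L
  have h : ∀ x : Fin (Module.finrank Q L) → (Q ⧸ Ideal.span {f₀}), f₀ • x = 0 :=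
    fun x => by ext i; exact hquot _
  have e1 : QuotSMulTop f₀ L ≃ₗ[Q] (Fin (Module.finrank Q L) → (Q ⧸ Ideal.span {f₀})) := by
    let p : L →ₗ[Q] (Fin (Module.finrank Q L) → (Q ⧸ Ideal.span {f₀})) :=
      LinearMap.pi (fun i => (Submodule.mkQ (Ideal.span {f₀})) ∘ₗ LinearMap.proj i) ∘ₗ
        b.equivFun.toLinearMap
    have hp : Function.Surjective p := by
      intro y
      choose z hz using fun i => Ideal.Quotient.mk_surjective (y i)
      refine ⟨b.equivFun.symm z, ?_⟩
      ext i
      simp only [p, LinearMap.comp_apply, LinearMap.pi_apply, LinearEquiv.coe_coe,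
        LinearEquiv.apply_symm_apply]
      exact hz i
    have hk : LinearMap.ker p = f₀ • ⊤ := by
      ext x
      rw [LinearMap.mem_ker, Submodule.mem_smul_pointwise_iff_exists]
      constructor
      · intro hx
        have : ∀ i, ∃ c, f₀ * c = b.equivFun x i := fun i => by
          have := congrFun hx i
          have := Ideal.Quotient.eq_zero_iff_mem.1 this
          obtain ⟨c, hc⟩ := Ideal.mem_span_singleton.1 this
          exact ⟨c, hc.symm⟩
        choose c hc using this
        refine ⟨b.equivFun.symm c, trivial, ?_⟩
        rw [← map_smul]
        apply b.equivFun.injective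
        rw [LinearEquiv.apply_symm_apply]
        ext i; exact hc i
      · rintro ⟨y, -, rfl⟩
        rw [map_smul]
        exact h _
    exact (Submodule.quotEquivOfEq _ _ hk.symm).trans (p.quotKerEquivOfSurjective hp)
  exact (van_equiv e1).2 (van_quot _ h)

end

section P3
open RingTheory.Sequence

theorem free_of_wreg (n : ℕ) : ∀ (Q : Type) [CommRing Q] [IsLocalRing Q] [IsNoetherianRing Q]
    (rs : List Q), rs.length = n → Ideal.ofList rs = maximalIdeal Q →
    ∀ (L : Type) [AddCommGroup L] [Module Q L] [Module.Finite Q L],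
    IsWeaklyRegular L rs → Module.Free Q L := by
  induction n with
  | zero =>
    intro Q _ _ _ rs h0 hm L _ _ _ _
    obtain rfl := List.length_eq_zero_iff.1 h0
    rw [Ideal.ofList_nil] at hm
    let := ((IsLocalRing.isField_iff_maximalIdeal_eq).2 hm.symm).toField
    exact Module.Free.of_divisionRing Q L
  | succ n ih =>
    intro Q _ _ _ rs h0 hm L _ _ _ hL
    match rs, h0 with
    | r :: rs, h0 =>
      rw [isWeaklyRegular_cons_iff'] at hL
      have hr : r ∈ maximalIdeal Q := by
        rw [← hm]; exact Ideal.subset_span (by simp)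
      have hne : Ideal.span {r} ≠ ⊤ := fun h =>
        (maximalIdeal.isMaximal Q).ne_top (top_le_iff.1 (h ▸ (Ideal.span_singleton_le_iff_mem _).2 hr))
      have : Nontrivial (Q ⧸ Ideal.span {r}) := Ideal.Quotient.nontrivial_iff.2 hne
      have : IsLocalRing (Q ⧸ Ideal.span {r}) :=
        IsLocalRing.of_surjective' (Ideal.Quotient.mk _) Ideal.Quotient.mk_surjective
      have hj : r ∈ (⊥ : Ideal Q).jacobson := by
        rw [IsLocalRing.jacobson_eq_maximalIdeal _ bot_ne_top]; exact hr
      have := Module.finitePresentation_of_finite Q L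
      rw [← Module.free_quotSMulTop_iff_free Q L hj hL.1]
      have := Module.Finite.of_restrictScalars_finite Q (Q ⧸ Ideal.span {r}) (QuotSMulTop r L)
      refine ih (Q ⧸ Ideal.span {r}) _ (by simpa using h0) ?_ _ hL.2
      have h1 : Ideal.ofList (rs.map (Ideal.Quotient.mk (Ideal.span {r}))) =
          (Ideal.ofList (r :: rs)).map (Ideal.Quotient.mk (Ideal.span {r})) := by
        rw [Ideal.ofList_cons, Ideal.map_sup, Ideal.map_quotient_self, bot_sup_eq, Ideal.map_ofList]
      rw [h1, hm]
      refine IsLocalRing.eq_maximalIdeal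
        ((Ideal.map_eq_top_or_isMaximal_of_surjective (Ideal.Quotient.mk (Ideal.span {r}))
          Ideal.Quotient.mk_surjective (maximalIdeal.isMaximal Q)).resolve_left ?_)
      intro ht
      have h2 := congrArg (Ideal.comap (Ideal.Quotient.mk (Ideal.span {r}))) ht
      rw [Ideal.comap_map_of_surjective _ Ideal.Quotient.mk_surjective, Ideal.comap_top,
        ← RingHom.ker_eq_comap_bot, Ideal.mk_ker,
        sup_eq_left.2 ((Ideal.span_singleton_le_iff_mem _).2 hr)] at h2
      exact (maximalIdeal.isMaximal Q).ne_top h2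

section
variable {Q : Type} [CommRing Q]
  {X Y Z : Type} [AddCommGroup X] [Module Q X] [AddCommGroup Y] [Module Q Y]
  [AddCommGroup Z] [Module Q Z]

theorem qst_inj {r : Q} (g : X →ₗ[Q] Y) (h : Y →ₗ[Q] Z) (hg : Function.Injective g)
     (he : Function.Exact g h) (hr : IsSMulRegular Z r) :
    Function.Injective (QuotSMulTop.map r g) := by
  have h0 : Function.Exact (0 : PUnit →ₗ[Q] X) g := by
    intro x
    constructor
    · intro hx; exact ⟨0, (hg (by simp [hx])).symm⟩
    · rintro ⟨y, rfl⟩; simp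
  have := QuotSMulTop.map_first_exact_on_four_term_exact_of_isSMulRegular_last h0 he hr
  rw [injective_iff_map_eq_zero]
  intro x hx
  obtain ⟨y, rfl⟩ := (this x).1 hx
  simp

theorem qst_surj {r : Q} (h : Y →ₗ[Q] Z) (hh : Function.Surjective h) :
    Function.Surjective (QuotSMulTop.map r h) := QuotSMulTop.map_surjective r hh

theorem qst_exact {r : Q} (g : X →ₗ[Q] Y) (h : Y →ₗ[Q] Z)
     (he : Function.Exact g h) (hh : Function.Surjective h) :
    Function.Exact (QuotSMulTop.map r g) (QuotSMulTop.map r h) := QuotSMulTop.map_exact r he hh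

end

theorem wreg_syz {Q : Type} [CommRing Q] (rs : List Q) : ∀ (j : ℕ)
  (X Y Z : Type) [AddCommGroup X] [Module Q X] [AddCommGroup Y] [Module Q Y]
  [AddCommGroup Z] [Module Q Z] (g : X →ₗ[Q] Y) (h : Y →ₗ[Q] Z), Function.Injective g →
    Function.Surjective h → Function.Exact g h → IsWeaklyRegular Y rs →
    IsWeaklyRegular Z (rs.take j) → IsWeaklyRegular X (rs.take (j+1)) := by
  induction rs with
  | nil => intros; simp
  | cons r rs ih =>
    intro j X Y Z _ _ _ _ _ _ g h hg hh he hY hZ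
    rw [isWeaklyRegular_cons_iff] at hY
    rw [List.take_succ_cons, isWeaklyRegular_cons_iff]
    refine ⟨hY.1.of_injective g hg, ?_⟩
    cases j with
    | zero => simp
    | succ j =>
      rw [List.take_succ_cons, isWeaklyRegular_cons_iff] at hZ
      exact ih j _ _ _ (QuotSMulTop.map r g) (QuotSMulTop.map r h) (qst_inj g h hg he hZ.1)
        (qst_surj h hh) (qst_exact g h he hh) hY.2 hZ.2

theorem wreg_pi {Q : Type} [CommRing Q] (rs : List Q) (h : IsWeaklyRegular Q rs) (r : ℕ) :
    IsWeaklyRegular (Fin r → Q) rs :=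
  ((TensorProduct.rid Q (Fin r → Q)).isWeaklyRegular_congr rs).1
    (h.isWeaklyRegular_lTensor (M₂ := (Fin r → Q)))

theorem reg_pi {Q : Type} [CommRing Q] (f : Q) (h : IsSMulRegular Q f) (r : ℕ) :
    IsSMulRegular (Fin r → Q) f := fun x y hxy => by
  ext i; exact h (congrFun hxy i)

theorem van_reg_aux {Q : Type} [CommRing Q] [IsLocalRing Q] [IsNoetherianRing Q] {f₀ : Q}
    (hf : IsSMulRegular Q f₀)
    {K : Type} [AddCommGroup K] [Module Q K] {hK : ∀ x : K, f₀ • x = 0}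
    (rs : List Q) (hrs : IsWeaklyRegular Q rs) (hm : Ideal.ofList rs = maximalIdeal Q) (d : ℕ) :
    ∀ (j : ℕ), rs.length ≤ j + d → ∀ (L : Type) [AddCommGroup L] [Module Q L] [Module.Finite Q L],
      IsWeaklyRegular L (rs.take j) → IsSMulRegular L f₀ → Van (hqst (f₀ := f₀) L) K hK := by
  induction d with
  | zero =>
    intro j hj L _ _ _ hL hL'
    rw [List.take_of_length_le (by omega : rs.length ≤ j)] at hL
    have := free_of_wreg _ Q rs rfl hm L hL
    exact van_free L
  | succ d ih =>
    intro j hj L _ _ _ hL hL'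
    obtain ⟨r, p, hp⟩ := Module.Finite.exists_fin' Q L
    have h1 := wreg_syz rs j _ _ _ (LinearMap.ker p).subtype p (Subtype.val_injective) hp
      (LinearMap.exact_subtype_ker_map p) (wreg_pi rs hrs r) hL
    have h2 := ih (j+1) (by omega) (LinearMap.ker p) h1
      ((reg_pi f₀ hf r).of_injective (LinearMap.ker p).subtype Subtype.val_injective)
    exact van3 (QuotSMulTop.map f₀ (LinearMap.ker p).subtype) (QuotSMulTop.map f₀ p)
      (qst_inj _ p Subtype.val_injective (LinearMap.exact_subtype_ker_map p) hL')
      (qst_surj p hp) (qst_exact _ _ (LinearMap.exact_subtype_ker_map p) hp) h2 (van_free _)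

theorem van_reg {Q : Type} [CommRing Q] [IsLocalRing Q] [IsNoetherianRing Q] {f₀ : Q}
    (hf : IsSMulRegular Q f₀)
    {K : Type} [AddCommGroup K] [Module Q K] {hK : ∀ x : K, f₀ • x = 0}
    (rs : List Q) (hrs : IsWeaklyRegular Q rs) (hm : Ideal.ofList rs = maximalIdeal Q)
    (L : Type) [AddCommGroup L] [Module Q L] [Module.Finite Q L] (h : IsSMulRegular L f₀) :
    Van (hqst (f₀ := f₀) L) K hK :=
  van_reg_aux hf rs hrs hm rs.length 0 (by omega) L (by simp) h

/-- quotients by regular sequences preserve `Van`. -/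
theorem van_list {Q : Type} [CommRing Q] {f₀ : Q}
    {K : Type} [AddCommGroup K] [Module Q K] {hK : ∀ x : K, f₀ • x = 0}
    (rs : List Q) : ∀ (X : Type) [AddCommGroup X] [Module Q X] (hX : ∀ x : X, f₀ • x = 0)
     (_ : IsWeaklyRegular X rs) (_ : Van hX K hK)
     (h : ∀ x : X ⧸ (Ideal.ofList rs • ⊤ : Submodule Q X), f₀ • x = 0), Van h K hK := by
  induction rs with
  | nil =>
    intro X _ _ hX h1 h2 h
    have e : (Ideal.ofList ([] : List Q) • ⊤ : Submodule Q X) = ⊥ := by simp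
    exact (van_equiv (Submodule.quotEquivOfEqBot _ e)).2 h2
  | cons r rs ih =>
    intro X _ _ hX h1 h2 h
    rw [isWeaklyRegular_cons_iff] at h1
    have hq : ∀ x : QuotSMulTop r X, f₀ • x = 0 := by
      intro x
      obtain ⟨x, rfl⟩ := Submodule.Quotient.mk_surjective _ x
      rw [← Submodule.Quotient.mk_smul, hX, Submodule.Quotient.mk_zero]
    have hv : Van hq K hK := by
      refine van3 (LinearMap.lsmul Q X r) (Submodule.mkQ _) h1.1 (Submodule.mkQ_surjective _) ?_ h2 h2
      intro x
      rw [Submodule.mkQ_apply, Submodule.Quotient.mk_eq_zero,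
        Submodule.mem_smul_pointwise_iff_exists]
      simp
    have e := Submodule.quotOfListConsSMulTopEquivQuotSMulTopInner X r rs
    have h' : ∀ x : QuotSMulTop r X ⧸ (Ideal.ofList rs • ⊤ : Submodule Q (QuotSMulTop r X)),
      f₀ • x = 0 := by
      intro x
      obtain ⟨x, rfl⟩ := Submodule.Quotient.mk_surjective _ x
      rw [← Submodule.Quotient.mk_smul, hq, Submodule.Quotient.mk_zero]
    exact (van_equiv e).2 (ih _ hq h1.2 hv h')

end P3


section P3b
open RingTheory.Sequence

section
variable {Q : Type} [CommRing Q] {c : ℕ} (f : Fin c → Q)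

def rest (i : Fin c) : List Q := ((List.finRange c).erase i).map f

theorem perm_rest (i : Fin c) : (List.ofFn f).Perm (f i :: rest f i) := by
  rw [List.ofFn_eq_map]
  exact (List.perm_cons_erase (List.mem_finRange i)).map f

theorem mem_rest {i j : Fin c} (h : j ≠ i) : f j ∈ Ideal.ofList (rest f i) := by
  apply Ideal.subset_span
  exact List.mem_map_of_mem ((List.mem_erase_of_ne h).2 (List.mem_finRange j))

theorem ofList_rest_le (i : Fin c) : Ideal.ofList (rest f i) ≤ Ideal.span (Set.range f) := by
  apply Ideal.span_mono
  rintro x hx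
  obtain ⟨j, -, rfl⟩ := List.mem_map.1 hx
  exact ⟨j, rfl⟩

theorem sum_sub_mem (i : Fin c) (a : Fin c → Q) :
    (∑ j, a j * f j) - a i * f i ∈ Ideal.ofList (rest f i) := by
  rw [← Finset.add_sum_erase _ _ (Finset.mem_univ i), add_sub_cancel_left]
  exact Ideal.sum_mem _ fun j hj => Ideal.mul_mem_left _ _ (mem_rest f (Finset.ne_of_mem_erase hj))

variable {f} [IsLocalRing Q] [IsNoetherianRing Q]

theorem wreg_rest (hf : IsWeaklyRegular Q (List.ofFn f)) (hm : ∀ i, f i ∈ maximalIdeal Q)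
    (i : Fin c) : IsWeaklyRegular Q (rest f i ++ [f i]) := by
  refine IsLocalRing.isWeaklyRegular_of_perm_of_subset_maximalIdeal hf
    ((perm_rest f i).trans (List.perm_append_singleton _ _).symm) ?_
  intro x hx
  obtain ⟨j, rfl⟩ := (List.mem_ofFn' _ _).1 hx
  exact hm j

theorem koszul (hf : IsWeaklyRegular Q (List.ofFn f)) (hm : ∀ i, f i ∈ maximalIdeal Q)
    (q : Fin c → Q) (hq : ∑ j, q j * f j = 0) (i : Fin c) : q i ∈ Ideal.span (Set.range f) := by
  apply ofList_rest_le f i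
  have h1 := ((isWeaklyRegular_append_iff _ _ _).1 (wreg_rest hf hm i)).2
  rw [isWeaklyRegular_singleton_iff, isSMulRegular_quotient_iff_mem_of_smul_mem] at h1
  have h2 := h1 (q i)
  simp only [smul_eq_mul, Ideal.mul_top] at h2
  apply h2
  have := sum_sub_mem f i q
  rw [hq, zero_sub, neg_mem_iff] at this
  rwa [mul_comm]

theorem wreg_cons (hf : IsWeaklyRegular Q (List.ofFn f)) (hm : ∀ i, f i ∈ maximalIdeal Q)
    (a : Fin c → Q) (i : Fin c) (hi : IsUnit (a i)) :
    IsWeaklyRegular Q ((∑ j, a j * f j) :: rest f i) := by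
  have h0 := wreg_rest hf hm i
  have h1 : IsWeaklyRegular Q (rest f i ++ [∑ j, a j * f j]) := by
    rw [isWeaklyRegular_append_iff, isWeaklyRegular_singleton_iff,
      isSMulRegular_quotient_iff_mem_of_smul_mem] at h0 ⊢
    refine ⟨h0.1, fun x hx => h0.2 x ?_⟩
    simp only [smul_eq_mul, Ideal.mul_top] at hx ⊢
    have h3 := Ideal.mul_mem_right x _ (sum_sub_mem f i a)
    have h4 := sub_mem hx h3
    obtain ⟨u, hu⟩ := hi
    have h5 := Ideal.mul_mem_left _ (↑u⁻¹ : Q) h4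
    convert h5 using 1
    rw [← hu]
    have := u.inv_mul
    linear_combination (-(f i * x)) * this
  refine IsLocalRing.isWeaklyRegular_of_perm_of_subset_maximalIdeal h1
    (List.perm_append_singleton _ _) ?_
  intro x hx
  rw [List.mem_append, List.mem_singleton] at hx
  rcases hx with hx | rfl
  · obtain ⟨j, -, rfl⟩ := List.mem_map.1 hx
    exact hm j
  · exact Ideal.sum_mem _ fun j _ => Ideal.mul_mem_left _ _ (hm j)

theorem reg_f0 (hf : IsWeaklyRegular Q (List.ofFn f)) (hm : ∀ i, f i ∈ maximalIdeal Q)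
    (a : Fin c → Q) (i : Fin c) (hi : IsUnit (a i)) : IsSMulRegular Q (∑ j, a j * f j) :=
  ((isWeaklyRegular_cons_iff _ _ _).1 (wreg_cons hf hm a i hi)).1

theorem span_cons (a : Fin c → Q) (i : Fin c) (hi : IsUnit (a i)) :
    Ideal.ofList ((∑ j, a j * f j) :: rest f i) = Ideal.span (Set.range f) := by
  rw [Ideal.ofList_cons]
  apply le_antisymm
  · refine sup_le ((Ideal.span_singleton_le_iff_mem _).2 ?_) (ofList_rest_le f i)
    exact Ideal.sum_mem _ fun j _ => Ideal.mul_mem_left _ _ (Ideal.subset_span ⟨j, rfl⟩)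
  · rw [Ideal.span_le]
    rintro _ ⟨j, rfl⟩
    by_cases hj : j = i
    · subst hj
      have h1 := Ideal.mem_sup_right (S := Ideal.span {∑ j, a j * f j}) (sum_sub_mem f j a)
      have h2 := Ideal.mem_sup_left (T := Ideal.ofList (rest f j))
        (Ideal.mem_span_singleton_self (∑ j, a j * f j))
      have h3 := sub_mem h2 h1
      rw [sub_sub_cancel] at h3
      obtain ⟨u, hu⟩ := hi
      have := Ideal.mul_mem_left _ (↑u⁻¹ : Q) h3
      rw [← hu, ← mul_assoc, u.inv_mul, one_mul] at this
      exact this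
    · exact Ideal.mem_sup_right (mem_rest f hj)

theorem van_I (hf : IsWeaklyRegular Q (List.ofFn f)) (hm : ∀ i, f i ∈ maximalIdeal Q)
    (a : Fin c → Q) (i : Fin c) (hi : IsUnit (a i)) {f₀ : Q} (h0 : f₀ = ∑ j, a j * f j)
    {K : Type} [AddCommGroup K] [Module Q K] {hK : ∀ x : K, f₀ • x = 0}
    (h : ∀ x : Q ⧸ Ideal.span (Set.range f), f₀ • x = 0) : Van h K hK := by
  subst h0
  have h1 := wreg_cons hf hm a i hi
  rw [isWeaklyRegular_cons_iff] at h1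
  have e1 := Submodule.quotOfListConsSMulTopEquivQuotSMulTopInner Q (∑ j, a j * f j) (rest f i)
  have e2 : (Ideal.ofList ((∑ j, a j * f j) :: rest f i) • ⊤ : Submodule Q Q) =
    Ideal.span (Set.range f) := by rw [span_cons a i hi]; simp
  have e3 := Submodule.quotEquivOfEq _ _ e2
  have h' : ∀ x : QuotSMulTop (∑ j, a j * f j) Q ⧸ (Ideal.ofList (rest f i) • ⊤ :
      Submodule Q (QuotSMulTop (∑ j, a j * f j) Q)), (∑ j, a j * f j) • x = 0 := by
    intro x
    obtain ⟨x, rfl⟩ := Submodule.Quotient.mk_surjective _ x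
    rw [← Submodule.Quotient.mk_smul, hqst, Submodule.Quotient.mk_zero]
  have h3 := van_list (K := K) (hK := hK) (rest f i) (QuotSMulTop (∑ j, a j * f j) Q) (hqst _)
    h1.2 (van_free _) h'
  exact (van_equiv (e1.symm.trans e3)).1 h3
end
end P3b


section P4

section
variable {Q : Type} [CommRing Q] 

/-- `f` is a matrix square with entries in `m` -/
def MSq (m : Ideal Q) (f : Q) : Prop :=
  ∃ (ι : Type) (_ : Fintype ι) (_ : DecidableEq ι) (_ : Nonempty ι) (δ : Matrix ι ι Q),
    (∀ i j, δ i j ∈ m) ∧ δ * δ = f • (1 : Matrix ι ι Q)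

theorem msq_step {m : Ideal Q} {f u v : Q} (hu : u ∈ m) (hv : v ∈ m) (h : MSq m f) :
    MSq m (f + u * v) := by
  obtain ⟨ι, _, _, _, δ, h1, h2⟩ := h
  refine ⟨ι ⊕ ι, inferInstance, inferInstance, inferInstance,
    Matrix.fromBlocks δ (u • 1) (v • 1) (-δ), ?_, ?_⟩
  · rintro (i | i) (j | j)
    · exact h1 i j
    · simp only [Matrix.fromBlocks_apply₁₂, Matrix.smul_apply, smul_eq_mul]
      exact Ideal.mul_mem_right _ _ hu
    · simp only [Matrix.fromBlocks_apply₂₁, Matrix.smul_apply, smul_eq_mul]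
      exact Ideal.mul_mem_right _ _ hv
    · simpa using h1 i j
  · rw [Matrix.fromBlocks_multiply, ← Matrix.fromBlocks_one, Matrix.fromBlocks_smul]
    congr 1
    · rw [h2]; simp [add_smul, smul_smul, mul_comm]
    · simp
    · simp
    · simp [h2, add_smul, smul_smul, add_comm]

theorem msq_of_mem {m : Ideal Q} {f : Q} (hf : f ∈ m ^ 2) : MSq m f := by
  have key : ∀ g, MSq m g → MSq m (g + f) := by
    rw [pow_two] at hf
    refine Submodule.mul_induction_on hf ?_ ?_
    · intro u hu v hv g hg
      exact msq_step hu hv hg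
    · intro x y hx hy g hg
      rw [← add_assoc]
      exact hy _ (hx _ hg)
  have := key 0 ⟨Unit, inferInstance, inferInstance, inferInstance, 0, by simp, by simp⟩
  rwa [zero_add] at this

variable {ι : Type} [Fintype ι] [DecidableEq ι] (δ : Matrix ι ι Q)
variable {X Y Z : Type} [AddCommGroup X] [Module Q X] [AddCommGroup Y] [Module Q Y]
  [AddCommGroup Z] [Module Q Z]

def DD (v : ι → X) (i : ι) : X := ∑ j, δ i j • v j

theorem DD_map (g : X →ₗ[Q] Y) (v : ι → X) : DD δ (fun i => g (v i)) = fun i => g (DD δ v i) := by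
  ext i; simp [DD]

theorem DD_sub (v w : ι → X) : DD δ (v - w) = DD δ v - DD δ w := by
  ext i; simp [DD, smul_sub]

theorem DD_DD {f₀ : Q} (h : δ * δ = f₀ • (1 : Matrix ι ι Q)) (v : ι → X) :
    DD δ (DD δ v) = fun i => f₀ • v i := by
  ext i
  simp only [DD, Finset.smul_sum, smul_smul]
  rw [Finset.sum_comm]
  simp_rw [← Finset.sum_smul]
  have : ∀ x, ∑ j, δ i j * δ j x = if i = x then f₀ else 0 := fun x => by
    have := congrFun (congrFun h i) x
    rw [Matrix.mul_apply] at this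
    rw [this]; simp [Matrix.one_apply]
  simp_rw [this]
  simp

variable (X) in
def HE : Prop := ∀ v : ι → X, DD δ v = 0 → ∃ w, DD δ w = v

theorem he_quot {f₀ : Q} (h : δ * δ = f₀ • (1 : Matrix ι ι Q)) (hf : IsSMulRegular Q f₀) :
    HE δ (Q ⧸ Ideal.span {f₀}) := by
  intro v hv
  choose q hq using fun i => Submodule.mkQ_surjective (Ideal.span {f₀}) (v i)
  obtain rfl : (fun i => Submodule.mkQ (Ideal.span {f₀}) (q i)) = v := funext hq
  rw [DD_map] at hv
  have h1 : ∀ i, ∃ p, f₀ * p = DD δ q i := fun i => by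
    have := congrFun hv i
    simp only [Submodule.mkQ_apply, Pi.zero_apply, Submodule.Quotient.mk_eq_zero] at this
    obtain ⟨p, hp⟩ := Ideal.mem_span_singleton.1 this
    exact ⟨p, hp.symm⟩
  choose p hp using h1
  refine ⟨fun i => Submodule.mkQ _ (p i), ?_⟩
  rw [DD_map]
  ext i
  congr 1
  apply hf
  change f₀ • DD δ p i = f₀ • q i
  have h2 := congrFun (DD_DD δ h q) i
  rw [← h2, ← funext hp]
  simp [DD, Finset.mul_sum, mul_left_comm]

theorem he_pi (hX : HE δ X) (r : ℕ) : HE δ (Fin r → X) := by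
  intro v hv
  have := fun s : Fin r => hX (fun i => v i s) (by
    have := DD_map δ (LinearMap.proj s : (Fin r → X) →ₗ[Q] X) v
    simp only [LinearMap.proj_apply] at this
    rw [this, hv]; rfl)
  choose w hw using this
  refine ⟨fun i s => w s i, ?_⟩
  ext i s
  have h1 := DD_map δ (LinearMap.proj s : (Fin r → X) →ₗ[Q] X) (fun i s => w s i)
  simp only [LinearMap.proj_apply] at h1
  rw [← congrFun h1 i, hw s]

theorem he_ses {f₀ : Q} (h : δ * δ = f₀ • (1 : Matrix ι ι Q)) (hY : ∀ y : Y, f₀ • y = 0)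
    (g : X →ₗ[Q] Y) (p : Y →ₗ[Q] Z) (hg : Function.Injective g)
    (hp : Function.Surjective p) (he : Function.Exact g p) (h1 : HE δ X) (h2 : HE δ Y) :
    HE δ Z := by
  intro v hv
  choose y hy using fun i => hp (v i)
  obtain rfl : (fun i => p (y i)) = v := funext hy
  rw [DD_map] at hv
  choose z hz using fun i => (he _).1 (congrFun hv i)
  have hz0 : DD δ z = 0 := by
    ext i
    apply hg
    rw [← congrFun (DD_map δ g z) i, funext hz]
    change DD δ (DD δ y) i = g 0
    rw [map_zero, DD_DD δ h]
    exact hY _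
  obtain ⟨z', rfl⟩ := h1 z hz0
  obtain ⟨y', hy'⟩ := h2 (y - fun i => g (z' i)) (by
    rw [DD_sub, DD_map, funext hz]; exact sub_self _)
  refine ⟨fun i => p (y' i), ?_⟩
  rw [DD_map, hy']
  ext i
  simp [he.apply_apply_eq_zero]

end

section
variable {Q : Type} [CommRing Q] {f₀ : Q}
variable {X : Type} [AddCommGroup X] [Module Q X]

/-- cover from generators -/
noncomputable def cover (hX : ∀ x : X, f₀ • x = 0) {r : ℕ} (e : Fin r → X) :
    (Fin r → Q ⧸ Ideal.span {f₀}) →ₗ[Q] X :=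
  ∑ i, (Submodule.liftQ (Ideal.span {f₀}) (LinearMap.toSpanSingleton Q X (e i))
    ((Ideal.span_singleton_le_iff_mem _).2 (by simpa using hX _))) ∘ₗ LinearMap.proj i

theorem cover_apply (hX : ∀ x : X, f₀ • x = 0) {r : ℕ} (e : Fin r → X) (q : Fin r → Q) :
    cover hX e (fun i => Submodule.mkQ (Ideal.span {f₀}) (q i)) = ∑ i, q i • e i := by
  simp only [cover, LinearMap.sum_apply, LinearMap.comp_apply, LinearMap.proj_apply,
    Submodule.mkQ_apply, Submodule.liftQ_apply, LinearMap.toSpanSingleton_apply]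

theorem cover_surj (hX : ∀ x : X, f₀ • x = 0) {r : ℕ} (e : Fin r → X)
    (he : Submodule.span Q (Set.range e) = ⊤) : Function.Surjective (cover hX e) := by
  intro x
  have : x ∈ Submodule.span Q (Set.range e) := he ▸ trivial
  obtain ⟨q, rfl⟩ := (Submodule.mem_span_range_iff_exists_fun Q).1 this
  exact ⟨_, cover_apply hX e q⟩

theorem exists_min [IsLocalRing Q] [Module.Finite Q X] : ∃ (r : ℕ) (e : Fin r → X),
    Submodule.span Q (Set.range e) = ⊤ ∧
      ∀ q : Fin r → Q, ∑ i, q i • e i = 0 → ∀ i, q i ∈ maximalIdeal Q := by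
  classical
  have h : ∃ r, ∃ e : Fin r → X, Submodule.span Q (Set.range e) = ⊤ := Module.Finite.exists_fin
  obtain ⟨e, he⟩ := Nat.find_spec h
  refine ⟨_, e, he, ?_⟩
  have hmin := fun m => Nat.find_min h (m := m)
  generalize Nat.find h = r at *
  intro q hq i
  by_contra hi
  rw [mem_maximalIdeal, mem_nonunits_iff, not_not] at hi
  obtain ⟨u, hu⟩ := hi
  match r, e, he, hmin, q, hq, i, u, hu with
  | 0, e, he, hmin, q, hq, i, u, hu => exact i.elim0
  | r+1, e, he, hmin, q, hq, i, u, hu =>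
    refine hmin r (Nat.lt_succ_self r) ⟨fun j => e (i.succAbove j), ?_⟩
    rw [← top_le_iff, ← he, Submodule.span_le]
    rintro _ ⟨j, rfl⟩
    have hmem : ∀ j : Fin r, e (i.succAbove j) ∈
      Submodule.span Q (Set.range fun j => e (i.succAbove j)) := fun j =>
        Submodule.subset_span ⟨j, rfl⟩
    by_cases hj : j = i
    · subst hj
      rw [Fin.sum_univ_succAbove _ j] at hq
      have h1 : q j • e j ∈ Submodule.span Q (Set.range fun i => e (j.succAbove i)) := by
        rw [eq_neg_of_add_eq_zero_left hq]
        exact neg_mem (Submodule.sum_mem _ fun i _ => Submodule.smul_mem _ _ (hmem i))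
      have h2 := Submodule.smul_mem _ (↑u⁻¹ : Q) h1
      rw [← hu, smul_smul, u.inv_mul, one_smul] at h2
      exact h2
    · obtain ⟨j', rfl⟩ := Fin.exists_succAbove_eq hj
      exact hmem j'

theorem exists_to_k [IsLocalRing Q] [Module.Finite Q X] [Nontrivial X] :
    ∃ φ : X →ₗ[Q] (Q ⧸ maximalIdeal Q), φ ≠ 0 := by
  have : IsCoatomic (Submodule Q X) := inferInstance
  obtain ⟨N, hN, -⟩ := (eq_top_or_exists_le_coatom (⊥ : Submodule Q X)).resolve_left bot_ne_top
  have hs : IsSimpleModule Q (X ⧸ N) := isSimpleModule_iff_isCoatom.2 hN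
  obtain ⟨J, hJ, ⟨e⟩⟩ := isSimpleModule_iff_quot_maximal.1 hs
  obtain rfl := IsLocalRing.eq_maximalIdeal hJ
  refine ⟨e.toLinearMap ∘ₗ N.mkQ, fun h => ?_⟩
  apply hN.1
  rw [← top_le_iff]
  intro x _
  have := LinearMap.congr_fun h x
  simpa using this

theorem hpiq (r : ℕ) (x : Fin r → Q ⧸ Ideal.span {f₀}) : f₀ • x = 0 := by
  ext i; exact hquot _

theorem hom_lin {Y : Type} [AddCommGroup Y] [Module Q Y] {hX : ∀ x : X, f₀ • x = 0}
    {hY : ∀ x : Y, f₀ • x = 0} (ψ : AObj f₀ X hX ⟶ AObj f₀ Y hY) :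
    ∃ g : X →ₗ[Q] Y, ψ = AHom f₀ g := 
  letI := (tors f₀ hX).module
  letI := (tors f₀ hY).module
  ⟨{ toFun := ψ.hom
     map_add' := ψ.hom.map_add
     map_smul' := fun t x => ψ.hom.map_smul (Ideal.Quotient.mk (Ideal.span {f₀}) t) x }, rfl⟩

theorem he_of_van [IsLocalRing Q] [IsNoetherianRing Q] {ι : Type} [Fintype ι] [DecidableEq ι]
    (δ : Matrix ι ι Q) (h : δ * δ = f₀ • (1 : Matrix ι ι Q)) (hf : IsSMulRegular Q f₀)
    (hK : ∀ x : Q ⧸ maximalIdeal Q, f₀ • x = 0) (n : ℕ) :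
    ∀ (X : Type) [AddCommGroup X] [Module Q X] [Module.Finite Q X] (hX : ∀ x : X, f₀ • x = 0),
    (∀ i ≥ n + 1, Subsingleton (EX hX (Q ⧸ maximalIdeal Q) hK i)) → HE δ X := by
  induction n with
  | zero =>
    intro X _ _ _ hX hv
    obtain ⟨r, e, he, hmin⟩ := exists_min (Q := Q) (X := X)
    let p := cover hX e
    have hp : Function.Surjective p := cover_surj hX e he
    have hZ : ∀ x : LinearMap.ker p, f₀ • x = 0 := fun x => Subtype.ext (hpiq r _)
    have hs := pre_surj (hX := hZ) (hY := hpiq r) (K := Q ⧸ maximalIdeal Q) (hK := hK)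
      (LinearMap.ker p).subtype p Subtype.val_injective hp
      (LinearMap.exact_subtype_ker_map p) 0 (hv 1 (by omega))
    have hZ0 : Subsingleton (LinearMap.ker p) := by
      by_contra hn
      rw [not_subsingleton_iff_nontrivial] at hn
      obtain ⟨φ, hφ⟩ := exists_to_k (Q := Q) (X := LinearMap.ker p)
      obtain ⟨y, hy⟩ := hs (Abelian.Ext.mk₀ (AHom f₀ (hX := hZ) (hY := hK) φ))
      obtain ⟨ψ, rfl⟩ := (Abelian.Ext.mk₀_bijective _ _).2 y
      rw [pre_apply, Abelian.Ext.mk₀_comp_mk₀] at hy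
      have hy' := (Abelian.Ext.mk₀_bijective _ _).1 hy
      apply hφ
      ext z
      have hz : φ z = ψ.hom z.1 := (congrArg (fun t => t.hom z) hy').symm
      rw [hz, LinearMap.zero_apply]
      choose q hq using fun i => Submodule.mkQ_surjective (Ideal.span {f₀}) (z.1 i)
      have hz2 : z.1 = fun i => Submodule.mkQ (Ideal.span {f₀}) (q i) := (funext hq).symm
      have hq0 := hmin q (by
        rw [← cover_apply hX e q, ← hz2]; exact z.2)
      have hz3 : z.1 = ∑ i, q i • (Pi.single i 1 : Fin r → Q ⧸ Ideal.span {f₀}) := by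
        rw [hz2]
        ext j
        simp [Finset.sum_apply, Pi.single_apply]
        rw [Algebra.smul_def, mul_one]; rfl
      obtain ⟨ψ', rfl⟩ := hom_lin ψ
      change ψ' z.1 = 0
      rw [hz3, map_sum]
      refine Finset.sum_eq_zero fun i _ => ?_
      rw [map_smul]
      generalize ψ' (Pi.single i 1) = y
      obtain ⟨y, rfl⟩ := Ideal.Quotient.mk_surjective y
      exact Ideal.Quotient.eq_zero_iff_mem.2 (Ideal.mul_mem_right _ _ (hq0 i))
    refine he_ses δ h (hpiq r) (LinearMap.ker p).subtype p Subtype.val_injective hp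
      (LinearMap.exact_subtype_ker_map p) ?_ (he_pi δ (he_quot δ h hf) r)
    intro v _
    exact ⟨0, funext fun i => Subsingleton.elim _ _⟩
  | succ n ih =>
    intro X _ _ _ hX hv
    obtain ⟨r, e, he, -⟩ := exists_min (Q := Q) (X := X)
    let p := cover hX e
    have hp : Function.Surjective p := cover_surj hX e he
    have hZ : ∀ x : LinearMap.ker p, f₀ • x = 0 := fun x => Subtype.ext (hpiq r _)
    refine he_ses δ h (hpiq r) (LinearMap.ker p).subtype p Subtype.val_injective hp
      (LinearMap.exact_subtype_ker_map p) (ih _ hZ fun i hi => ?_) (he_pi δ (he_quot δ h hf) r)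
    have hs := pre_surj (hX := hZ) (hY := hpiq r) (K := Q ⧸ maximalIdeal Q) (hK := hK)
      (LinearMap.ker p).subtype p Subtype.val_injective hp
      (LinearMap.exact_subtype_ker_map p) i (hv (i+1) (by omega))
    obtain ⟨j, rfl⟩ : ∃ j, i = j + 1 := ⟨i-1, by omega⟩
    have := EX_quot (K := Q ⧸ maximalIdeal Q) (hK := hK) r j (hpiq (f₀ := f₀) r)
    exact hs.subsingleton

theorem not_van_k [IsLocalRing Q] [IsNoetherianRing Q] (hf : IsSMulRegular Q f₀)
    (hm : f₀ ∈ maximalIdeal Q ^ 2) (hK hK' : ∀ x : Q ⧸ maximalIdeal Q, f₀ • x = 0) :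
    ¬ Van hK' (Q ⧸ maximalIdeal Q) hK := by
  rintro ⟨n, hn⟩
  obtain ⟨ι, _, _, ⟨i⟩, δ, h1, h2⟩ := msq_of_mem hm
  have hz : ∀ v : ι → Q ⧸ maximalIdeal Q, DD δ v = 0 := by
    intro v
    ext i
    refine Finset.sum_eq_zero fun j _ => ?_
    generalize v j = y
    obtain ⟨y, rfl⟩ := Ideal.Quotient.mk_surjective y
    exact Ideal.Quotient.eq_zero_iff_mem.2 (Ideal.mul_mem_right _ _ (h1 i j))
  obtain ⟨w, hw⟩ := he_of_van δ h2 hf hK n (Q ⧸ maximalIdeal Q) hK' (fun i hi => hn i (by omega))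
    (fun _ => 1) (hz _)
  rw [hz w] at hw
  exact zero_ne_one (congrFun hw i)

end
end P4


section P5

section
variable {Q : Type} [CommRing Q] {n : ℕ} (M : Type) [AddCommGroup M] [Module Q M]

/-- action of a matrix on `M^n` -/
def bl (C : Matrix (Fin n) (Fin n) Q) : (Fin n → M) →ₗ[Q] (Fin n → M) :=
  LinearMap.pi fun i => ∑ s, C i s • LinearMap.proj s

theorem bl_apply (C : Matrix (Fin n) (Fin n) Q) (x : Fin n → M) (i : Fin n) :
    bl M C x i = ∑ s, C i s • x s := by
  simp [bl]

theorem bl_one : bl M (1 : Matrix (Fin n) (Fin n) Q) = LinearMap.id := by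
  ext x i
  simp [bl_apply, Matrix.one_apply, ite_smul]

theorem bl_mul (C D : Matrix (Fin n) (Fin n) Q) : bl M (C * D) = bl M C ∘ₗ bl M D := by
  refine LinearMap.ext fun x => funext fun i => ?_
  simp only [LinearMap.comp_apply, bl_apply, Matrix.mul_apply, Finset.sum_smul, Finset.smul_sum,
    smul_smul]
  exact Finset.sum_comm

theorem bl_sum {c : ℕ} (a : Fin c → Q) (B : Fin c → Matrix (Fin n) (Fin n) Q) (x : Fin n → M) :
    bl M (∑ j, a j • B j) x = ∑ j, a j • bl M (B j) x := by
  refine funext fun i => ?_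
  simp only [Finset.sum_apply, Pi.smul_apply, bl_apply, Matrix.sum_apply, Matrix.smul_apply,
    Finset.sum_smul, Finset.smul_sum, smul_smul, smul_eq_mul]
  exact Finset.sum_comm

variable {M} {f₀ : Q} [IsLocalRing Q]
variable (hM : ∀ x : M, f₀ • x = 0)
  (hK : ∀ x : Q ⧸ maximalIdeal Q, f₀ • x = 0)

theorem k_smul_zero {r : Q} (hr : r ∈ maximalIdeal Q) (x : Q ⧸ maximalIdeal Q) : r • x = 0 := by
  obtain ⟨y, rfl⟩ := Ideal.Quotient.mk_surjective x
  exact Ideal.Quotient.eq_zero_iff_mem.2 (Ideal.mul_mem_right _ _ hr)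

theorem pre_sum_zero {Y : Type} [AddCommGroup Y] [Module Q Y] (hY : ∀ x : Y, f₀ • x = 0)
    {ι : Type} (S : Finset ι) (w : ι → Q) (hw : ∀ s, w s ∈ maximalIdeal Q) (g : ι → M →ₗ[Q] Y)
    (i : ℕ) (x : EX hY (Q ⧸ maximalIdeal Q) hK i) :
    pre hM hY (Q ⧸ maximalIdeal Q) hK (∑ s ∈ S, w s • g s) i x = 0 := by
  classical
  induction S using Finset.induction_on with
  | empty =>
    rw [Finset.sum_empty, ← zero_smul Q (0 : M →ₗ[Q] Y), pre_smul, map_zero]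
    exact zero_smul _ _
  | insert s S hs ih =>
    rw [Finset.sum_insert hs, pre_add, ih, pre_smul, EX_smul_zero, add_zero]
    exact k_smul_zero (hw s)

theorem evBij_bl (hN : ∀ x : Fin n → M, f₀ • x = 0) (C : Matrix (Fin n) (Fin n) Q) :
    EvBij hN hN (Q ⧸ maximalIdeal Q) hK (bl M C) ↔
      (Van hM (Q ⧸ maximalIdeal Q) hK ∨ IsUnit C.det) := by
  constructor
  · rintro ⟨m, hm⟩
    by_contra! hcon
    obtain ⟨hv, hd⟩ := hcon
    have hd0 : ((Ideal.Quotient.mk (maximalIdeal Q)).mapMatrix C).det = 0 := by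
      rw [← RingHom.map_det]
      exact Ideal.Quotient.eq_zero_iff_mem.2 hd
    let _ : Field (Q ⧸ maximalIdeal Q) := Ideal.Quotient.field _
    obtain ⟨v', hv0, hv1⟩ := Matrix.exists_mulVec_eq_zero_iff.2 hd0
    choose v hvv using fun s => Ideal.Quotient.mk_surjective (v' s)
    obtain ⟨s, hs⟩ := Function.ne_iff.1 hv0
    have hu : IsUnit (v s) := by
      by_contra h
      exact hs ((hvv s).symm.trans (Ideal.Quotient.eq_zero_iff_mem.2 h))
    have hw : ∀ i, (∑ s, C i s * v s) ∈ maximalIdeal Q := fun i => by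
      rw [← Ideal.Quotient.eq_zero_iff_mem, map_sum]
      have := congrFun hv1 i
      simp only [Matrix.mulVec, dotProduct, RingHom.mapMatrix_apply, Matrix.map_apply,
        ← hvv, Pi.zero_apply, ← map_mul] at this
      exact this
    let ιv : M →ₗ[Q] (Fin n → M) := LinearMap.pi fun s => v s • LinearMap.id
    have e1 : bl M C ∘ₗ ιv = ∑ i, (∑ s, C i s * v s) • LinearMap.single Q (fun _ : Fin n => M) i := by
      refine LinearMap.ext fun x => funext fun i => ?_
      simp [ιv, bl_apply, Finset.sum_apply, Pi.single_apply, smul_smul, Finset.sum_smul]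
    apply hv
    refine ⟨m, fun i hi => subsingleton_of_forall_eq 0 fun x => ?_⟩
    obtain ⟨y, hy⟩ := (hm i hi).2 (pre hN hM _ hK (LinearMap.proj s) i x)
    have h1 : pre hM hM _ hK (LinearMap.proj s ∘ₗ ιv) i x = 0 := by
      rw [pre_comp hM hN hM, ← hy, ← pre_comp, e1]
      exact pre_sum_zero hM hK hN _ _ hw _ i y
    have e2 : LinearMap.proj s ∘ₗ ιv = v s • LinearMap.id := rfl
    rw [e2, pre_smul, pre_id] at h1
    exact ((hu.map (Ideal.Quotient.mk (Ideal.span {f₀}))).smul_eq_zero).1 h1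
  · rintro (h | h)
    · have := van_pi h n hN
      exact evBij_of_van _ this this
    · exact evBij_equiv (LinearEquiv.ofLinear (bl M C) (bl M C⁻¹)
        (by rw [← bl_mul, Matrix.mul_nonsing_inv _ h, bl_one])
        (by rw [← bl_mul, Matrix.nonsing_inv_mul _ h, bl_one]))

theorem exists_desc {F N P : Type} [AddCommGroup F] [Module Q F] [AddCommGroup N] [Module Q N]
    [AddCommGroup P] [Module Q P] (π : F →ₗ[Q] N) (hπ : Function.Surjective π) (t : F →ₗ[Q] P)
    (h : ∀ x, π x = 0 → t x = 0) : ∃ t' : N →ₗ[Q] P, ∀ x, t' (π x) = t x := by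
  refine ⟨(LinearMap.ker π).liftQ t (fun x hx => h x hx) ∘ₗ
    (π.quotKerEquivOfSurjective hπ).symm.toLinearMap, fun x => ?_⟩
  simp only [LinearMap.comp_apply, LinearEquiv.coe_coe]
  have : (π.quotKerEquivOfSurjective hπ).symm (π x) = (LinearMap.ker π).mkQ x := by
    rw [LinearEquiv.symm_apply_eq]; rfl
  rw [this]; exact Submodule.liftQ_apply _ _ _

end

section
variable {Q : Type} [CommRing Q] {c : ℕ} (f : Fin c → Q)
variable {n m : ℕ} {M : Type} [AddCommGroup M] [Module Q M]
variable (B : Fin c → Matrix (Fin n) (Fin n) Q) (π : (Fin m → Q) →ₗ[Q] (Fin n → M))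

theorem fN (hM : ∀ j, ∀ x : M, f j • x = 0) (j : Fin c) (x : Fin n → M) : f j • x = 0 := funext fun i => hM j _

/-- multiplication by `r` from `F` to `L` -/
def mulL (r : Q) (hr : ∀ x : Fin n → M, r • x = 0) : (Fin m → Q) →ₗ[Q] LinearMap.ker π :=
  (r • (LinearMap.id : (Fin m → Q) →ₗ[Q] _)).codRestrict _ fun q => by
    simp [hr]

variable (hM : ∀ j, ∀ x : M, f j • x = 0)

def Phi : (Fin c → Fin m → Q) →ₗ[Q] (Fin n → M) × LinearMap.ker π :=
  LinearMap.prod (∑ j, bl M (B j) ∘ₗ π ∘ₗ LinearMap.proj j)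
    (-∑ j, mulL π (f j) (fN f hM j) ∘ₗ LinearMap.proj j)

theorem Phi_fst (q : Fin c → Fin m → Q) :
    (Phi f B π hM q).1 = ∑ j, bl M (B j) (π (q j)) := by
  simp [Phi]

theorem Phi_snd (q : Fin c → Fin m → Q) :
    ((Phi f B π hM q).2 : Fin m → Q) = -∑ j, f j • q j := by
  simp [Phi, mulL]

abbrev MM : Type := ((Fin n → M) × LinearMap.ker π) ⧸ LinearMap.range (Phi f B π hM)

theorem MM_tors (j : Fin c) (x : MM f B π hM) : f j • x = 0 := by
  obtain ⟨⟨x, l⟩, rfl⟩ := Submodule.Quotient.mk_surjective _ x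
  rw [← Submodule.Quotient.mk_smul, Submodule.Quotient.mk_eq_zero]
  refine ⟨-Pi.single j l.1, ?_⟩
  refine Prod.ext ?_ (Subtype.ext ?_)
  · rw [Phi_fst]
    change _ = f j • x
    rw [fN f hM]
    refine Finset.sum_eq_zero fun i _ => ?_
    by_cases h : i = j
    · subst h; simp
    · simp [h]
  · rw [Phi_snd]
    change _ = f j • l.1
    rw [Finset.sum_eq_single j]
    · simp
    · intro i _ h; simp [h]
    · simp

variable [IsLocalRing Q] [IsNoetherianRing Q]
open RingTheory.Sequence

open Pointwise in
theorem step_main (hπ : Function.Surjective π)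
    (rs : List Q) (hrs : IsWeaklyRegular Q rs) (hrm : Ideal.ofList rs = maximalIdeal Q)
    (hf : IsWeaklyRegular Q (List.ofFn f)) (hm : ∀ i, f i ∈ maximalIdeal Q)
    (a : Fin c → Q) (i : Fin c) (hi : IsUnit (a i)) (f₀ : Q) (h0 : f₀ = ∑ j, a j * f j)
    (hK : ∀ x : Q ⧸ maximalIdeal Q, f₀ • x = 0)
    (hM0 : ∀ x : M, f₀ • x = 0) (hMM : ∀ x : MM f B π hM, f₀ • x = 0) :
    Van hMM (Q ⧸ maximalIdeal Q) hK ↔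
      (Van hM0 (Q ⧸ maximalIdeal Q) hK ∨ IsUnit (∑ j, a j • B j).det) := by
  have hreg : IsSMulRegular Q f₀ := h0 ▸ reg_f0 hf hm a i hi
  have hN : ∀ x : Fin n → M, f₀ • x = 0 := fun x => funext fun i => hM0 _
  have hT : Van (hqst (f₀ := f₀) (LinearMap.ker π)) (Q ⧸ maximalIdeal Q) hK :=
    van_reg hreg rs hrs hrm _
      ((reg_pi f₀ hreg m).of_injective (LinearMap.ker π).subtype Subtype.val_injective)
  let T := QuotSMulTop f₀ (LinearMap.ker π)
  have hNT : ∀ x : (Fin n → M) × T, f₀ • x = 0 := fun x => Prod.ext (hN _) (hqst _ _)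
  let cl : ((Fin n → M) × LinearMap.ker π) →ₗ[Q] MM f B π hM := Submodule.mkQ _
  -- the map `s`
  obtain ⟨s, hs⟩ := exists_desc (P := MM f B π hM)
    (LinearMap.prodMap (LinearMap.id : (Fin n → M) →ₗ[Q] (Fin n → M))
      (Submodule.mkQ (f₀ • ⊤ : Submodule Q (LinearMap.ker π))))
    (Function.Surjective.prodMap Function.surjective_id (Submodule.mkQ_surjective _)) cl (by
      rintro ⟨x, l⟩ hx
      simp only [LinearMap.prodMap_apply, LinearMap.id_apply, Prod.mk_eq_zero, Submodule.mkQ_apply,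
        Submodule.Quotient.mk_eq_zero, Submodule.mem_smul_pointwise_iff_exists] at hx
      obtain ⟨rfl, l, -, rfl⟩ := hx
      have : ((0 : Fin n → M), f₀ • l) = f₀ • ((0 : Fin n → M), l) := by simp
      rw [this, map_smul, hMM])
  replace hs : ∀ x l, s (x, Submodule.mkQ (f₀ • ⊤ : Submodule Q (LinearMap.ker π)) l) = cl (x, l) :=
    fun x l => hs (x, l)
  have hss : Function.Surjective s := by
    intro y
    obtain ⟨⟨x, l⟩, rfl⟩ := Submodule.mkQ_surjective _ y
    exact ⟨_, hs x l⟩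
  have hcl : ∀ x l, cl (x, l) = 0 ↔ ∃ q, Phi f B π hM q = (x, l) := fun x l => by
    rw [Submodule.mkQ_apply, Submodule.Quotient.mk_eq_zero]; rfl
  let W := LinearMap.ker s
  have hW : ∀ x : W, f₀ • x = 0 := fun x => Subtype.ext (hNT _)
  -- the map `t`
  obtain ⟨t, ht⟩ := exists_desc (P := (Fin n → M) × T) π hπ
    (LinearMap.prod (bl M (∑ j, a j • B j) ∘ₗ π)
      (-(Submodule.mkQ (f₀ • ⊤ : Submodule Q (LinearMap.ker π)) ∘ₗ mulL π f₀ hN))) (by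
    intro q hq
    refine Prod.ext ?_ ?_
    · simp [hq]
    · change -(Submodule.mkQ (f₀ • ⊤ : Submodule Q (LinearMap.ker π)) (mulL π f₀ hN q)) = 0
      rw [neg_eq_zero, Submodule.mkQ_apply, Submodule.Quotient.mk_eq_zero,
        Submodule.mem_smul_pointwise_iff_exists]
      exact ⟨⟨q, hq⟩, trivial, rfl⟩)
  replace ht : ∀ q, t (π q) = (bl M (∑ j, a j • B j) (π q),
      Submodule.mkQ (f₀ • ⊤ : Submodule Q (LinearMap.ker π)) (-mulL π f₀ hN q)) := fun q => by
    rw [ht]; simp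
  have htW : ∀ x, t x ∈ W := by
    intro x
    obtain ⟨q, rfl⟩ := hπ x
    rw [LinearMap.mem_ker, ht, hs, hcl]
    refine ⟨fun j => a j • q, Prod.ext ?_ (Subtype.ext ?_)⟩
    · rw [Phi_fst, bl_sum]
      simp
    · rw [Phi_snd]
      change _ = -(f₀ • q)
      rw [h0]
      simp [Finset.sum_smul, smul_smul, mul_comm]
  have htinj : Function.Injective t := by
    rw [injective_iff_map_eq_zero]
    intro x hx
    obtain ⟨q, rfl⟩ := hπ x
    rw [ht, Prod.mk_eq_zero, Submodule.mkQ_apply, Submodule.Quotient.mk_eq_zero,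
      Submodule.mem_smul_pointwise_iff_exists] at hx
    obtain ⟨-, l, -, hl⟩ := hx
    have hl' : f₀ • l.1 = - (f₀ • q) := congrArg Subtype.val hl
    have : -l.1 = q := reg_pi f₀ hreg m (by
      change f₀ • (-l.1) = f₀ • q
      rw [smul_neg, hl', neg_neg])
    rw [← this, map_neg, neg_eq_zero]
    exact l.2
  let t' : (Fin n → M) →ₗ[Q] W := t.codRestrict W htW
  -- the map `v`
  let F := Fin m → Q
  let J : Ideal Q := Ideal.span (Set.range f)
  have hf0J : f₀ ∈ J := h0 ▸ Ideal.sum_mem _ fun j _ =>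
    Ideal.mul_mem_left _ _ (Ideal.subset_span ⟨j, rfl⟩)
  have hQJ : ∀ x : Q ⧸ J, f₀ • x = 0 := fun x => by
    obtain ⟨y, rfl⟩ := Ideal.Quotient.mk_surjective x
    exact Ideal.Quotient.eq_zero_iff_mem.2 (Ideal.mul_mem_right _ _ hf0J)
  have hFJ : ∀ x : Fin m → Q ⧸ J, f₀ • x = 0 := fun x => funext fun i => hQJ _
  have hvFJ : Van hFJ (Q ⧸ maximalIdeal Q) hK := van_pi (van_I hf hm a i hi h0 hQJ) m hFJ
  let v0 : F →ₗ[Q] (Fin m → Q ⧸ J) := LinearMap.pi fun i => Submodule.mkQ J ∘ₗ LinearMap.proj i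
  have hv0 : ∀ q, v0 q = 0 ↔ ∀ i, q i ∈ J := fun q => by
    rw [funext_iff]
    refine forall_congr' fun i => ?_
    exact Submodule.Quotient.mk_eq_zero J
  have hv0s : Function.Surjective v0 := by
    intro y
    choose z hz using fun i => Submodule.mkQ_surjective J (y i)
    exact ⟨z, funext hz⟩
  obtain ⟨v, hv⟩ := exists_desc (Submodule.mkQ (f₀ • ⊤ : Submodule Q F)) (Submodule.mkQ_surjective _)
    v0 (by
      intro q hq
      rw [Submodule.mkQ_apply, Submodule.Quotient.mk_eq_zero,
        Submodule.mem_smul_pointwise_iff_exists] at hq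
      obtain ⟨q, -, rfl⟩ := hq
      rw [map_smul, hFJ])
  have hvs : Function.Surjective v := fun y => by
    obtain ⟨z, rfl⟩ := hv0s y
    exact ⟨_, hv z⟩
  let G := LinearMap.ker v
  have hG : ∀ x : G, f₀ • x = 0 := fun x => Subtype.ext (hqst F _)
  have hvG : Van hG (Q ⧸ maximalIdeal Q) hK :=
    van1 G.subtype v Subtype.val_injective hvs (LinearMap.exact_subtype_ker_map v) 
      (van_free F) hvFJ
  -- the map `u`
  let u : W →ₗ[Q] QuotSMulTop f₀ F := QuotSMulTop.map f₀ (LinearMap.ker π).subtype ∘ₗ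
    LinearMap.snd Q _ _ ∘ₗ W.subtype
  have hu : ∀ x l h, u ⟨(x, Submodule.mkQ (f₀ • ⊤ : Submodule Q (LinearMap.ker π)) l), h⟩ =
    Submodule.mkQ (f₀ • ⊤ : Submodule Q F) l.1 := fun x l h => rfl
  have hWrep : ∀ w : W, ∃ x l h, w =
      ⟨(x, Submodule.mkQ (f₀ • ⊤ : Submodule Q (LinearMap.ker π)) l), h⟩ ∧
      ∃ q, Phi f B π hM q = (x, l) := by
    rintro ⟨⟨x, l⟩, h⟩
    obtain ⟨l, rfl⟩ := Submodule.mkQ_surjective _ l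
    exact ⟨x, l, h, rfl, by rw [← hcl, ← hs]; exact h⟩
  have huG : ∀ w, u w ∈ G := by
    intro w
    obtain ⟨x, l, h, rfl, q, hq⟩ := hWrep w
    rw [hu, LinearMap.mem_ker, hv, hv0]
    have h1 : l.1 = _ := (congrArg (fun z => z.2.1) hq).symm
    intro i
    rw [h1, Phi_snd, Pi.neg_apply, Finset.sum_apply]
    exact neg_mem (Ideal.sum_mem _ fun j _ => 
      Ideal.mul_mem_right _ _ (Ideal.subset_span ⟨j, rfl⟩))
  let u' : W →ₗ[Q] G := u.codRestrict G huG
  have hu's : Function.Surjective u' := by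
    rintro ⟨y, hy⟩
    obtain ⟨q, rfl⟩ := Submodule.mkQ_surjective _ y
    rw [LinearMap.mem_ker, hv, hv0] at hy
    choose p hp using fun i => (Ideal.mem_span_range_iff_exists_fun).1 (hy i)
    let p' : Fin c → Fin m → Q := fun j i => - p i j
    have e1 : ((Phi f B π hM p').2 : Fin m → Q) = q := by
      rw [Phi_snd]
      ext i
      rw [← hp i]
      simp [p', Finset.sum_apply, mul_comm]
    have hw : s ((Phi f B π hM p').1,
        Submodule.mkQ (f₀ • ⊤ : Submodule Q (LinearMap.ker π)) (Phi f B π hM p').2) = 0 := by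
      rw [hs, hcl]; exact ⟨p', rfl⟩
    refine ⟨⟨_, hw⟩, Subtype.ext ?_⟩
    refine (hu _ (Phi f B π hM p').2 hw).trans ?_
    rw [e1]
  have hex : Function.Exact t' u' := by
    intro w
    constructor
    · intro hw
      obtain ⟨x, l, h, rfl, q, hq⟩ := hWrep w
      have h1 : u _ = 0 := congrArg Subtype.val hw
      rw [hu, Submodule.mkQ_apply, Submodule.Quotient.mk_eq_zero,
        Submodule.mem_smul_pointwise_iff_exists] at h1
      obtain ⟨q', -, hq'⟩ := h1
      have h2 : l.1 = -∑ j, f j • q j := (congrArg (fun z => z.2.1) hq).symm.trans (Phi_snd ..)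
      have h3 : x = ∑ j, bl M (B j) (π (q j)) :=
        (congrArg (fun z => z.1) hq).symm.trans (Phi_fst ..)
      have h4 : ∀ j, π (q j) = - (a j • π q') := by
        intro j
        rw [eq_neg_iff_add_eq_zero, ← map_smul, ← map_add]
        have h5 : ∀ z, (q j + a j • q') z ∈ J := fun z => by
          refine koszul hf hm (fun j => (q j + a j • q') z) ?_ j
          have h6 := congrFun (hq'.trans h2) z
          change f₀ * q' z = _ at h6
          simp only [Pi.smul_apply, Pi.neg_apply, Finset.sum_apply, smul_eq_mul, h0] at h6
          change ∑ j, (q j z + a j * q' z) * f j = 0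
          simp only [add_mul, Finset.sum_add_distrib]
          rw [eq_neg_iff_add_eq_zero, Finset.sum_mul] at h6
          rw [← h6, add_comm]
          congr 1
          · exact Finset.sum_congr rfl fun _ _ => by ring
          · exact Finset.sum_congr rfl fun _ _ => by ring
        choose p hp using fun z => (Ideal.mem_span_range_iff_exists_fun).1 (h5 z)
        have h7 : q j + a j • q' = ∑ i, f i • (fun z => p z i) := by
          ext z
          rw [← hp z]
          simp [Finset.sum_apply, mul_comm]
        rw [h7, map_sum]
        exact Finset.sum_eq_zero fun i _ => by rw [map_smul, fN f hM]
      refine ⟨-π q', Subtype.ext ?_⟩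
      change t (-π q') = (x, _)
      rw [← map_neg, ht]
      refine Prod.ext ?_ ?_
      · change bl M _ _ = x
        rw [h3, bl_sum]
        refine Finset.sum_congr rfl fun j _ => ?_
        rw [h4]; simp
      · change Submodule.mkQ _ _ = Submodule.mkQ _ _
        congr 1
        apply Subtype.ext
        rw [← hq']
        simp [mulL]
    · rintro ⟨x, rfl⟩
      obtain ⟨q, rfl⟩ := hπ x
      apply Subtype.ext
      change QuotSMulTop.map f₀ (LinearMap.ker π).subtype (t (π q)).2 = 0
      rw [ht]
      change Submodule.mkQ (f₀ • ⊤ : Submodule Q F) (-mulL π f₀ hN q).1 = 0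
      rw [Submodule.mkQ_apply, Submodule.Quotient.mk_eq_zero,
        Submodule.mem_smul_pointwise_iff_exists]
      exact ⟨-q, trivial, by simp [mulL]⟩
  have ht'b : EvBij hN hW (Q ⧸ maximalIdeal Q) hK t' :=
    (van_iff_evBij t' u' (fun x y h => htinj (congrArg Subtype.val h)) hu's hex).1 hvG
  rw [van_iff_evBij (hX := hW) (hY := hNT) W.subtype s Subtype.val_injective hss
    (LinearMap.exact_subtype_ker_map s), ← ht'b.comp_iff_left,
    ← (evBij_fst (hX := hN) hT hNT).comp_iff_right]
  have e : LinearMap.fst Q (Fin n → M) T ∘ₗ W.subtype ∘ₗ t' = bl M (∑ j, a j • B j) := by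
    refine LinearMap.ext fun x => ?_
    obtain ⟨q, rfl⟩ := hπ x
    change (t (π q)).1 = _
    rw [ht]
  rw [e]
  exact evBij_bl hM0 hK hN _

end
end P5


section P6
open RingTheory.Sequence
variable {Q : Type} [CommRing Q] {c : ℕ} (f : Fin c → Q)

theorem iterate_main [IsLocalRing Q] [IsNoetherianRing Q]
    (rs : List Q) (hrs : IsWeaklyRegular Q rs) (hrm : Ideal.ofList rs = maximalIdeal Q)
    (hf : IsWeaklyRegular Q (List.ofFn f)) (hm2 : ∀ i, f i ∈ maximalIdeal Q ^ 2)
    (L : List (Σ n : ℕ, Fin c → Matrix (Fin n) (Fin n) Q)) :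
    ∃ (M : Type) (iM : AddCommGroup M), letI := iM; ∃ (mQM : Module Q M), letI := mQM;
      ∃ (_ : Module.Finite Q M) (_ : ∀ j, ∀ x : M, f j • x = 0),
      ∀ (a : Fin c → Q) (i : Fin c) (_ : IsUnit (a i)) (f₀ : Q) (_ : f₀ = ∑ j, a j * f j)
        (hK : ∀ x : Q ⧸ maximalIdeal Q, f₀ • x = 0) (hM0 : ∀ x : M, f₀ • x = 0),
        Van hM0 (Q ⧸ maximalIdeal Q) hK ↔ ∃ S ∈ L, IsUnit (∑ j, a j • S.2 j).det := by
  have hm : ∀ i, f i ∈ maximalIdeal Q := fun i => Ideal.pow_le_self two_ne_zero (hm2 i)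
  induction L with
  | nil =>
    refine ⟨Q ⧸ maximalIdeal Q, inferInstance, inferInstance, inferInstance,
      fun j x => k_smul_zero (hm j) x, fun a i hi f₀ h0 hK hM0 => ?_⟩
    have hreg : IsSMulRegular Q f₀ := h0 ▸ reg_f0 hf hm a i hi
    have : ¬ Van hM0 (Q ⧸ maximalIdeal Q) hK := not_van_k hreg
      (h0 ▸ Ideal.sum_mem _ fun j _ => Ideal.mul_mem_left _ _ (hm2 j)) hK hM0
    simp [this]
  | cons S L ih =>
    obtain ⟨M, iM, mM, hfin, hM, h⟩ := ih
    obtain ⟨m, π, hπ⟩ := Module.Finite.exists_fin' Q (Fin S.1 → M)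
    refine ⟨MM f S.2 π hM, inferInstance, inferInstance, inferInstance, MM_tors f S.2 π hM,
      fun a i hi f₀ h0 hK hM0 => ?_⟩
    have hM1 : ∀ x : M, f₀ • x = 0 := fun x => by
      rw [h0, Finset.sum_smul]
      exact Finset.sum_eq_zero fun j _ => by rw [mul_smul, hM, smul_zero]
    rw [step_main f S.2 π hM hπ rs hrs hrm hf hm a i hi f₀ h0 hK hM1 hM0,
      h a i hi f₀ h0 hK hM1, List.exists_mem_cons_iff, or_comm]

end P6


section P7
open MvPolynomial Matrix
variable {k : Type} [Field k] {c : ℕ}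

/-- Linear representation of a function, given by a linear pencil. -/
def PRep (i₀ : Fin c) (g : (Fin c → k) → k) : Prop :=
  ∃ n : ℕ, ∃ (T : (Fin c → k) →ₗ[k] Matrix (Fin n) (Fin n) k)
    (v w : (Fin c → k) →ₗ[k] (Fin n → k)),
    ∀ a, a i₀ ≠ 0 → IsUnit (T a).det ∧ ∃ u, T a *ᵥ u = v a ∧ w a ⬝ᵥ u = g a

theorem PRep.of (i₀ : Fin c) (g : (Fin c → k) → k) {n : Type} [Fintype n] [DecidableEq n]
    (T : (Fin c → k) →ₗ[k] Matrix n n k) (v w : (Fin c → k) →ₗ[k] (n → k))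
    (h : ∀ a, a i₀ ≠ 0 → IsUnit (T a).det ∧ ∃ u, T a *ᵥ u = v a ∧ w a ⬝ᵥ u = g a) :
    PRep i₀ g := by
  let e := Fintype.equivFin n
  refine ⟨Fintype.card n, (Matrix.reindexLinearEquiv k k e e).toLinearMap ∘ₗ T,
    (LinearMap.funLeft k k e.symm) ∘ₗ v, (LinearMap.funLeft k k e.symm) ∘ₗ w, fun a ha => ?_⟩
  obtain ⟨h1, u, h2, h3⟩ := h a ha
  refine ⟨?_, u ∘ e.symm, ?_, ?_⟩
  · simpa using h1
  · simp only [LinearMap.comp_apply, LinearEquiv.coe_coe, reindexLinearEquiv_apply, reindex_apply]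
    rw [Matrix.submatrix_mulVec_equiv, Equiv.symm_symm, Function.comp_assoc, e.symm_comp_self,
      Function.comp_id, h2]
    rfl
  · rw [← h3]
    exact Equiv.sum_comp e.symm (fun i => w a i * u i)

theorem rep_const (i₀ : Fin c) (r : k) : PRep i₀ (fun a => r * a i₀) := by
  refine PRep.of (n := Unit) i₀ _
    { toFun := fun a => Matrix.of fun _ _ => a i₀, map_add' := fun _ _ => rfl, map_smul' := fun _ _ => rfl }
    { toFun := fun a => fun _ => a i₀, map_add' := fun _ _ => rfl, map_smul' := fun _ _ => rfl }
    { toFun := fun a => fun _ => r * a i₀, map_add' := fun _ _ => funext fun _ => mul_add _ _ _,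
      map_smul' := fun _ _ => funext fun _ => mul_left_comm _ _ _ } fun a ha => ⟨?_, 1, ?_, ?_⟩
  · rw [Matrix.det_unique, isUnit_iff_ne_zero]
    exact ha
  · ext
    change ∑ _ : Unit, a i₀ * 1 = a i₀
    simp
  · simp [dotProduct]

theorem PRep.add {i₀ : Fin c} {g h : (Fin c → k) → k} (hg : PRep i₀ g) (hh : PRep i₀ h) :
    PRep i₀ (fun a => g a + h a) := by
  obtain ⟨n, T, v, w, H⟩ := hg
  obtain ⟨n', T', v', w', H'⟩ := hh
  refine PRep.of (n := Fin n ⊕ Fin n') i₀ _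
    { toFun := fun a => fromBlocks (T a) 0 0 (T' a)
      map_add' := fun _ _ => by simp [fromBlocks_add]
      map_smul' := fun _ _ => by simp [fromBlocks_smul] }
    { toFun := fun a => Sum.elim (v a) (v' a)
      map_add' := fun _ _ => by ext (_|_) <;> simp
      map_smul' := fun _ _ => by ext (_|_) <;> simp }
    { toFun := fun a => Sum.elim (w a) (w' a)
      map_add' := fun _ _ => by ext (_|_) <;> simp
      map_smul' := fun _ _ => by ext (_|_) <;> simp } fun a ha => ?_
  obtain ⟨h1, u, h2, h3⟩ := H a ha
  obtain ⟨h1', u', h2', h3'⟩ := H' a ha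
  refine ⟨?_, Sum.elim u u', ?_, ?_⟩
  · simp only [LinearMap.coe_mk, AddHom.coe_mk, det_fromBlocks_zero₂₁]
    exact h1.mul h1'
  · simp [fromBlocks_mulVec, h2, h2']
  · simp [← h3, ← h3', dotProduct]

theorem PRep.mulVar {i₀ : Fin c} {g : (Fin c → k) → k} (hg : PRep i₀ g) (j : Fin c) :
    PRep i₀ (fun a => g a * (a j / a i₀)) := by
  obtain ⟨n, T, v, w, H⟩ := hg
  refine PRep.of (n := Fin n ⊕ Unit) i₀ _
    { toFun := fun a => fromBlocks (T a) (Matrix.of fun i _ => - v a i) 0 (Matrix.of fun _ _ => a i₀)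
      map_add' := fun _ _ => by ext (_|_) (_|_) <;> simp [add_comm]
      map_smul' := fun _ _ => by ext (_|_) (_|_) <;> simp }
    { toFun := fun a => Sum.elim 0 (fun _ => a j)
      map_add' := fun _ _ => by ext (_|_) <;> simp
      map_smul' := fun _ _ => by ext (_|_) <;> simp }
    { toFun := fun a => Sum.elim (w a) 0
      map_add' := fun _ _ => by ext (_|_) <;> simp
      map_smul' := fun _ _ => by ext (_|_) <;> simp } fun a ha => ?_
  obtain ⟨h1, u, h2, h3⟩ := H a ha
  refine ⟨?_, Sum.elim ((a j / a i₀) • u) (fun _ => a j / a i₀), ?_, ?_⟩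
  · simp only [LinearMap.coe_mk, AddHom.coe_mk, det_fromBlocks_zero₂₁]
    exact h1.mul (by simpa [Matrix.det_unique] using ha)
  · simp only [LinearMap.coe_mk, AddHom.coe_mk, fromBlocks_mulVec]
    ext (i|i)
    · simp [mulVec_smul, h2]
      simp [mulVec, dotProduct, mul_comm]
    · simp [mulVec, dotProduct]; field_simp
  · simp only [LinearMap.coe_mk, AddHom.coe_mk, ← h3]
    simp [dotProduct, Finset.sum_mul]
    exact Finset.sum_congr rfl fun _ _ => by ring


theorem rep_poly (i₀ : Fin c) (p : MvPolynomial (Fin c) k) :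
    PRep i₀ (fun a => eval (fun j => a j / a i₀) p * a i₀) := by
  induction p using MvPolynomial.induction_on with
  | C r => simpa using rep_const i₀ r
  | add p q hp hq => simpa [add_mul] using hp.add hq
  | mul_X p j hp => 
    have := hp.mulVar j
    simpa [mul_right_comm] using this

theorem exists_pencil (i₀ : Fin c) (p : MvPolynomial (Fin c) k) (d : ℕ) (hp : p.IsHomogeneous d) :
    ∃ n : ℕ, ∃ T : (Fin c → k) →ₗ[k] Matrix (Fin n) (Fin n) k,
      ∀ a, IsUnit (T a).det ↔ (a i₀ ≠ 0 ∧ eval a p ≠ 0) := by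
  obtain ⟨n, T, v, w, H⟩ := rep_poly i₀ p
  let T' : (Fin c → k) →ₗ[k] Matrix ((Fin n ⊕ Unit) ⊕ Unit) ((Fin n ⊕ Unit) ⊕ Unit) k :=
    { toFun := fun a => fromBlocks (fromBlocks (T a) (Matrix.of fun i _ => v a i) (Matrix.of fun _ i => w a i) 0) 0 0
        (Matrix.of fun _ _ => a i₀)
      map_add' := fun _ _ => by ext ((_|_)|_) ((_|_)|_) <;> simp
      map_smul' := fun _ _ => by ext ((_|_)|_) ((_|_)|_) <;> simp }
  let e := Fintype.equivFin ((Fin n ⊕ Unit) ⊕ Unit)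
  refine ⟨_, (Matrix.reindexLinearEquiv k k e e).toLinearMap ∘ₗ T', fun a => ?_⟩
  have e1 : (((Matrix.reindexLinearEquiv k k e e).toLinearMap ∘ₗ T') a).det =
      (fromBlocks (T a) (Matrix.of fun i (_ : Unit) => v a i) (Matrix.of fun (_ : Unit) i => w a i) 0).det * a i₀ := by
    simp [T', Matrix.det_unique]
  rw [e1, isUnit_iff_ne_zero, mul_ne_zero_iff, and_comm, and_congr_right_iff]
  intro ha
  obtain ⟨h1, u, h2, h3⟩ := H a ha
  have := h1
  have hinv : Invertible (T a) := (T a).invertibleOfIsUnitDet h1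
  rw [det_fromBlocks₁₁, Matrix.det_unique (n := Unit)]
  have e2 : (Matrix.of fun (_ : Unit) i => w a i) * ⅟(T a) * (Matrix.of fun i (_ : Unit) => v a i) =
      Matrix.of fun (_ _ : Unit) => w a ⬝ᵥ u := by
    have : (Matrix.of fun i (_ : Unit) => v a i) = T a * (Matrix.of fun i (_ : Unit) => u i) := by
      ext i _; exact (congrFun h2 i).symm
    rw [Matrix.mul_assoc, this, ← Matrix.mul_assoc (⅟(T a)), invOf_mul_self, Matrix.one_mul]
    rfl
  rw [e2, h3]
  have e3 : eval a p = a i₀ ^ d * eval (fun j => a j / a i₀) p := by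
    rw [eval_eq, eval_eq, Finset.mul_sum]
    refine Finset.sum_congr rfl fun s hs => ?_
    have hd : ∑ j, s j = d := by
      rw [← hp (mem_support_iff.1 hs), Finsupp.weight_apply, Finsupp.sum_fintype _ _ (by simp)]
      simp
    have e4 : ∏ j ∈ s.support, a j ^ s j = a i₀ ^ d * ∏ j ∈ s.support, (a j / a i₀) ^ s j := by
      rw [← hd, Finset.prod_subset (Finset.subset_univ s.support) (by simp +contextual),
        Finset.prod_subset (Finset.subset_univ s.support) (by simp +contextual),
        ← Finset.prod_pow_eq_pow_sum, ← Finset.prod_mul_distrib]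
      exact Finset.prod_congr rfl fun j _ => by rw [← mul_pow, mul_div_cancel₀ _ ha]
    rw [e4, mul_left_comm]
  rw [e3]
  simp [h1.ne_zero, ha]

end P7


section P8
open MvPolynomial Matrix

theorem mk_ne_zero_iff {Q : Type} [CommRing Q] [IsLocalRing Q] (x : Q) :
    Ideal.Quotient.mk (maximalIdeal Q) x ≠ 0 ↔ IsUnit x := by
  rw [Ne, Ideal.Quotient.eq_zero_iff_mem, mem_maximalIdeal, mem_nonunits_iff, not_not]

theorem exists_lift {Q : Type} [CommRing Q] [IsLocalRing Q] {c : ℕ} (i₀ : Fin c)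
    (p : MvPolynomial (Fin c) (Q ⧸ maximalIdeal Q)) (d : ℕ) (hp : p.IsHomogeneous d) :
    ∃ S : Σ n : ℕ, Fin c → Matrix (Fin n) (Fin n) Q, ∀ a : Fin c → Q,
      IsUnit (∑ j, a j • S.2 j).det ↔
        (IsUnit (a i₀) ∧ eval (fun i => Ideal.Quotient.mk (maximalIdeal Q) (a i)) p ≠ 0) := by
  letI : Field (Q ⧸ maximalIdeal Q) := Ideal.Quotient.field _
  obtain ⟨n, T, hT⟩ := exists_pencil i₀ p d hp
  choose B hB using fun (j : Fin c) (s t : Fin n) =>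
    Ideal.Quotient.mk_surjective (T (Pi.single j 1) s t)
  refine ⟨⟨n, fun j => Matrix.of (B j)⟩, fun a => ?_⟩
  have h := hT (fun i => Ideal.Quotient.mk (maximalIdeal Q) (a i))
  rw [isUnit_iff_ne_zero, mk_ne_zero_iff] at h
  rw [← h, ← mk_ne_zero_iff, RingHom.map_det]
  have e : (Ideal.Quotient.mk (maximalIdeal Q)).mapMatrix (∑ j, a j • Matrix.of (B j)) =
      T (fun i => Ideal.Quotient.mk (maximalIdeal Q) (a i)) := by
    rw [LinearMap.pi_apply_eq_sum_univ T]
    ext s t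
    simp only [RingHom.mapMatrix_apply, Matrix.map_apply, Matrix.sum_apply, map_sum,
      Matrix.smul_apply, smul_eq_mul, map_mul, Matrix.of_apply, hB]
    refine Finset.sum_congr rfl fun j _ => ?_
    have e2 : (Pi.single j 1 : Fin c → Q ⧸ maximalIdeal Q) = fun i => if j = i then 1 else 0 := by
      ext i
      simp [Pi.single_apply, eq_comm]
    rw [e2]
  rw [e]

theorem exists_systems {Q : Type} [CommRing Q] [IsLocalRing Q] {c : ℕ}
    (𝔞 : Ideal (MvPolynomial (Fin c) (Q ⧸ maximalIdeal Q)))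
    (h𝔞 : ∀ p ∈ 𝔞, ∀ n : ℕ, MvPolynomial.homogeneousComponent n p ∈ 𝔞) :
    ∃ L : List (Σ n : ℕ, Fin c → Matrix (Fin n) (Fin n) Q), ∀ a : Fin c → Q,
      (∃ i, IsUnit (a i)) → ((∃ S ∈ L, IsUnit (∑ j, a j • S.2 j).det) ↔
        ¬ ∀ p ∈ 𝔞, eval (fun i => Ideal.Quotient.mk (maximalIdeal Q) (a i)) p = 0) := by
  have : IsNoetherianRing (Q ⧸ maximalIdeal Q) := by
    letI : Field (Q ⧸ maximalIdeal Q) := Ideal.Quotient.field _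
    infer_instance
  obtain ⟨G, hG⟩ := (isNoetherianRing_iff_ideal_fg _).1
    (inferInstance : IsNoetherianRing (MvPolynomial (Fin c) (Q ⧸ maximalIdeal Q))) 𝔞
  choose S hS using fun (x : Fin c × MvPolynomial (Fin c) (Q ⧸ maximalIdeal Q) × ℕ) =>
    exists_lift x.1 (homogeneousComponent x.2.2 x.2.1) x.2.2
      (homogeneousComponent_isHomogeneous _ _)
  let N := G.sup totalDegree
  let X := (Finset.univ : Finset (Fin c)) ×ˢ (G ×ˢ Finset.range (N + 1))
  refine ⟨X.toList.map S, fun a ha => ?_⟩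
  obtain ⟨i, hi⟩ := ha
  constructor
  · rintro ⟨s, hs, hu⟩ h
    obtain ⟨x, hx, rfl⟩ := List.mem_map.1 hs
    rw [hS] at hu
    have hx1 := Finset.mem_toList.1 hx
    simp only [X, Finset.mem_product] at hx1
    exact hu.2 (h _ (h𝔞 _ (hG ▸ Ideal.subset_span hx1.2.1) _))
  · intro h
    by_contra hne
    apply h
    have key : ∀ g ∈ G, eval (fun i => Ideal.Quotient.mk (maximalIdeal Q) (a i)) g = 0 := by
      intro g hg
      rw [← sum_homogeneousComponent g, map_sum]
      refine Finset.sum_eq_zero fun d hd => ?_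
      by_contra h0
      refine hne ⟨S (i, g, d), List.mem_map.2 ⟨_, Finset.mem_toList.2 ?_, rfl⟩,
        (hS _ _).2 ⟨hi, h0⟩⟩
      simp only [X, Finset.mem_product, Finset.mem_univ, true_and]
      refine ⟨hg, Finset.mem_range.2 ((Finset.mem_range.1 hd).trans_le ?_)⟩
      exact Nat.succ_le_succ (Finset.le_sup (f := totalDegree) hg)
    intro p hp
    have : 𝔞 ≤ RingHom.ker (eval (fun i => Ideal.Quotient.mk (maximalIdeal Q) (a i))) := by
      rw [← hG]
      exact Ideal.span_le.2 fun g hg => key g hg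
    exact this hp

end P8


/-- Realizability for first-order support varieties: every closed cone,
given by a homogeneous ideal `𝔞`, is the support variety of some finitely generated module. -/
theorem statement12
    (Q : Type) [CommRing Q] [IsLocalRing Q] [IsNoetherianRing Q]
    (hQreg : IsRegularLocal Q)
    (c : ℕ) (hc : 1 ≤ c) (f : Fin c → Q)
    (hfreg : RingTheory.Sequence.IsRegular Q (List.ofFn f))
    (I : Ideal Q) (hIf : I = Ideal.span (Set.range f))
    (hIsq : I ≤ maximalIdeal Q ^ 2)
    [IsAlgClosed (ResidueField Q)]
    (𝔞 : Ideal (MvPolynomial (Fin c) (Q ⧸ maximalIdeal Q)))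
    (h𝔞 : ∀ p ∈ 𝔞, ∀ n : ℕ, MvPolynomial.homogeneousComponent n p ∈ 𝔞) :
    ∃ (M : Type) (iM : AddCommGroup M), letI := iM; ∃ (mQM : Module Q M), letI := mQM;
      ∃ (_ : Module.Finite Q M) (hM : Module.IsTorsionBySet Q M (I : Set Q)),
      ∀ (f₀ : Q) (hf₀ : f₀ ∈ I), f₀ ∉ maximalIdeal Q * I →
        ∀ a : Fin c → Q, (f₀ - ∑ i, a i * f i) ∈ maximalIdeal Q * I →
          (extInf (Q ⧸ Ideal.span {f₀}) M (Q ⧸ maximalIdeal Q)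
              (modOver (Ideal.span {f₀}) ((Ideal.span_singleton_le_iff_mem I).mpr hf₀) M hM)
              (kMod (Ideal.span {f₀}) (((Ideal.span_singleton_le_iff_mem I).mpr hf₀).trans
                (hIsq.trans (Ideal.pow_le_self two_ne_zero)))) ↔
            ∀ p ∈ 𝔞, MvPolynomial.eval
              (fun i => Ideal.Quotient.mk (maximalIdeal Q) (a i)) p = 0) := by
  obtain ⟨rs, hrs, hrm⟩ := hQreg
  have hrm' : Ideal.ofList rs = maximalIdeal Q := hrm
  have hfI : ∀ j, f j ∈ I := fun j => hIf ▸ Ideal.subset_span ⟨j, rfl⟩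
  obtain ⟨L, hL⟩ := exists_systems 𝔞 h𝔞
  obtain ⟨M, iM, mM, hfin, hMf, H⟩ := iterate_main f rs hrs.toIsWeaklyRegular hrm'
    hfreg.toIsWeaklyRegular (fun j => hIsq (hfI j)) L
  have hMI : Module.IsTorsionBySet Q M (I : Set Q) := by
    rw [hIf, ← Module.isTorsionBySet_iff_is_torsion_by_span]
    rintro x ⟨_, j, rfl⟩
    exact hMf j x
  refine ⟨M, iM, mM, hfin, hMI, fun f₀ hf₀ hf₀n a ha => ?_⟩
  have hex : ∃ e : Fin c → Q, (∀ j, e j ∈ maximalIdeal Q) ∧ f₀ - ∑ i, a i * f i = ∑ j, e j * f j := by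
    have h1 : maximalIdeal Q * I = maximalIdeal Q • Submodule.span Q (Set.range f) := by
      rw [hIf]; rfl
    rw [h1, Submodule.mem_ideal_smul_span_iff_exists_sum] at ha
    obtain ⟨e, he, h2⟩ := ha
    refine ⟨e, he, ?_⟩
    rw [← h2, Finsupp.sum_fintype _ _ (by simp)]
    rfl
  obtain ⟨e, he, hsum⟩ := hex
  let b : Fin c → Q := fun j => a j + e j
  have h0 : f₀ = ∑ j, b j * f j := by
    simp only [b, add_mul, Finset.sum_add_distrib]
    rw [← hsum]; ring
  have hb : (fun i => Ideal.Quotient.mk (maximalIdeal Q) (a i)) =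
      fun i => Ideal.Quotient.mk (maximalIdeal Q) (b i) := by
    ext i
    simp only [b, map_add]
    rw [Ideal.Quotient.eq_zero_iff_mem.2 (he i), add_zero]
  have hu : ∃ i, IsUnit (b i) := by
    by_contra hne
    push Not at hne
    refine hf₀n (h0 ▸ Ideal.sum_mem _ fun j _ => Ideal.mul_mem_mul ?_ (hfI j))
    exact (mem_maximalIdeal _).2 (hne j)
  obtain ⟨i, hi⟩ := hu
  have hK : ∀ x : Q ⧸ maximalIdeal Q, f₀ • x = 0 :=
    fun x => k_smul_zero (Ideal.pow_le_self two_ne_zero (hIsq hf₀)) x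
  have hM0 : ∀ x : M, f₀ • x = 0 := fun x => @hMI x ⟨f₀, hf₀⟩
  have h1 := (H b i hi f₀ h0 hK hM0).trans (hL b ⟨i, hi⟩)
  rw [hb, ← not_iff_not, ← h1]
  have hS : ∀ p : ℕ, Subsingleton (extMod (Q ⧸ Ideal.span {f₀}) M (Q ⧸ maximalIdeal Q)
      (modOver (Ideal.span {f₀}) ((Ideal.span_singleton_le_iff_mem I).mpr hf₀) M hMI)
      (kMod (Ideal.span {f₀}) (((Ideal.span_singleton_le_iff_mem I).mpr hf₀).trans
        (hIsq.trans (Ideal.pow_le_self two_ne_zero)))) (p + 1)) ↔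
      Subsingleton (EX hM0 (Q ⧸ maximalIdeal Q) hK (p + 1)) := fun p =>
    bridge (AObj f₀ M hM0) (AObj f₀ (Q ⧸ maximalIdeal Q) hK) p
  unfold extInf
  constructor
  · intro h
    push Not at h
    obtain ⟨n, hn⟩ := h
    refine ⟨n + 1, fun i hi => ?_⟩
    obtain ⟨p, rfl⟩ : ∃ p, i = p + 1 := ⟨i - 1, by omega⟩
    exact (hS p).1 (not_nontrivial_iff_subsingleton.1 (fun h' => by
      have := hn (p + 1) (by omega)
      exact not_nontrivial_iff_subsingleton.2 this h'))
  · rintro ⟨n, hn⟩ h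
    obtain ⟨i, hi, hnt⟩ := h (n + 1)
    obtain ⟨p, rfl⟩ : ∃ p, i = p + 1 := ⟨i - 1, by omega⟩
    exact not_nontrivial_iff_subsingleton.2 ((hS p).2 (hn (p + 1) (by omega))) hnt
end
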